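/- arXiv:1606.02974 — 12 statements merged into one kernel-verified Lean document; each statement's English description precedes it below -/
import Mathlib

section
/- Let n ≥ 3 and s ≥ 1. The scheme X ⊆ P^n consisting of s generic lines and one generic double line 2L has good postulation in degree d = 2, i.e. h^0(I_X(2)) = max{ C(n+2, n) − (2n+1) − 3s, 0 } = max{ C(n, 2) − 3s, 0 }, except in the single case {n = 4, s = 2}, in which case h^0(I_X(2)) = 1 instead of the expected 0. -/
open MvPolynomial

/-- The `k`-dimension of the degree-`d` homogeneous component of an ideal `I`
of the polynomial ring in `m` variables; this is `h^0(I_X(d))` when `I` is the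
defining ideal of the subscheme `X` of projective space. -/
noncomputable def homIdealDim (k : Type*) [Field k] (m : ℕ)
    (I : Ideal (MvPolynomial (Fin m) k)) (d : ℕ) : ℕ :=
  Module.finrank k
    ↥(Submodule.restrictScalars k I ⊓ MvPolynomial.homogeneousSubmodule (Fin m) k d)

/-- The saturated homogeneous ideal of the projective linear subspace of `P^(m-1)`
whose affine cone is the linear subspace `W ⊆ k^m`: all polynomials vanishing on `W`. -/
noncomputable def subspaceIdeal (k : Type*) [Field k] (m : ℕ)
    (W : Submodule k (Fin m → k)) : Ideal (MvPolynomial (Fin m) k) :=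
  RingHom.ker (Pi.ringHom (fun x : W => MvPolynomial.eval (x : Fin m → k)))

/-- The bilinear form `B` restricts to zero on the span of the pair `p` (for symmetric `B`). -/
def VanishesOnPair {k V : Type*} [Field k] [AddCommGroup V] [Module k V]
    (B : V →ₗ[k] V →ₗ[k] k) (p : V × V) : Prop :=
  B p.1 p.1 = 0 ∧ B p.1 p.2 = 0 ∧ B p.2 p.2 = 0

section Pairs

variable {k V : Type*} [Field k] [CharZero k] [AddCommGroup V] [Module k V]

/-- Three lines in `P³` impose independent conditions on quadrics through a point. -/
lemma vanish_of_three_pairs (B : V →ₗ[k] V →ₗ[k] k) (hB : ∀ x y, B x y = B y x)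
    (e f₁ f₂ f₃ : V) (he : B e e = 0) (h₁ : VanishesOnPair B (f₁, f₂))
    (h₂ : VanishesOnPair B (f₃, f₁ + e)) (h₃ : VanishesOnPair B (f₂ + e, f₁ + f₃)) :
    (B e f₁ = 0 ∧ B e f₂ = 0 ∧ B e f₃ = 0) ∧ B f₁ f₁ = 0 ∧ B f₁ f₂ = 0 ∧ B f₁ f₃ = 0 ∧
      B f₂ f₂ = 0 ∧ B f₂ f₃ = 0 ∧ B f₃ f₃ = 0 := by
  simp only [VanishesOnPair, map_add, LinearMap.add_apply, hB f₁ e, hB f₂ e, hB f₃ e,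
    hB f₂ f₁, hB f₃ f₁] at *
  grind

/-- Four lines in `P⁴` impose independent conditions on quadrics containing a fixed line. -/
lemma vanish_of_four_pairs (B : V →ₗ[k] V →ₗ[k] k) (hB : ∀ x y, B x y = B y x)
    (e e' f₁ f₂ f₃ : V) (he : B e e = 0) (hee' : B e e' = 0) (he' : B e' e' = 0)
    (h₁ : VanishesOnPair B (f₁, f₂)) (h₂ : VanishesOnPair B (f₃, f₁ + e))
    (h₃ : VanishesOnPair B (f₂ + e, f₃ + e')) (h₄ : VanishesOnPair B (f₁ + e', f₂ + f₃)) :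
    (B e f₁ = 0 ∧ B e f₂ = 0 ∧ B e f₃ = 0) ∧ (B e' f₁ = 0 ∧ B e' f₂ = 0 ∧ B e' f₃ = 0) ∧
      B f₁ f₁ = 0 ∧ B f₁ f₂ = 0 ∧ B f₁ f₃ = 0 ∧ B f₂ f₂ = 0 ∧ B f₂ f₃ = 0 ∧ B f₃ f₃ = 0 := by
  simp only [VanishesOnPair, map_add, LinearMap.add_apply, hB f₁ e, hB f₂ e, hB f₃ e,
    hB f₁ e', hB f₂ e', hB f₃ e', hB f₃ f₁, hB f₃ f₂] at *
  grind

lemma vanish_of_two_pairs (B : V →ₗ[k] V →ₗ[k] k) (hB : ∀ x y, B x y = B y x)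
    (e e' f₁ f₂ f₃ : V) (he : B e e = 0) (hee' : B e e' = 0) (he' : B e' e' = 0)
    (hf : B f₁ f₁ = 0 ∧ B f₁ f₂ = 0 ∧ B f₁ f₃ = 0 ∧ B f₂ f₂ = 0 ∧ B f₂ f₃ = 0 ∧ B f₃ f₃ = 0)
    (h₁ : VanishesOnPair B (e + f₁, e' + f₂)) (h₂ : VanishesOnPair B (e' + f₁, e + f₃)) :
    (B e f₁ = 0 ∧ B e f₂ = 0 ∧ B e f₃ = 0) ∧ (B e' f₁ = 0 ∧ B e' f₂ = 0 ∧ B e' f₃ = 0) := by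
  simp only [VanishesOnPair, map_add, LinearMap.add_apply, hB f₁ e, hB f₃ e,
    hB f₁ e', hB f₂ e', hB e' e] at *
  grind

/-- Seven lines in `P⁵` lying on no quadric. -/
lemma vanish_of_seven_pairs (B : V →ₗ[k] V →ₗ[k] k) (hB : ∀ x y, B x y = B y x)
    (e : ℕ → V) (h₁ : VanishesOnPair B (e 0, e 1)) (h₂ : VanishesOnPair B (e 2, e 3))
    (h₃ : VanishesOnPair B (e 4, e 5)) (h₄ : VanishesOnPair B (e 0 + e 2, e 1 + e 3))
    (h₅ : VanishesOnPair B (e 0 + e 4, e 1 + e 5)) (h₆ : VanishesOnPair B (e 2 + e 4, e 3 + e 5))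
    (h₇ : VanishesOnPair B (e 0 + e 2 + e 5, e 1 - e 3 + e 4)) :
    ∀ i < 6, ∀ j < 6, B (e i) (e j) = 0 := by
  simp only [VanishesOnPair, map_add, map_sub, LinearMap.add_apply, LinearMap.sub_apply,
    hB (e 2) (e 0), hB (e 4) (e 0), hB (e 5) (e 0),
    hB (e 2) (e 1), hB (e 3) (e 1), hB (e 4) (e 1), hB (e 5) (e 1),
    hB (e 4) (e 2), hB (e 5) (e 2),
    hB (e 4) (e 3), hB (e 5) (e 3), hB (e 5) (e 4)] at *
  have h : B (e 0) (e 3) = 0 := by grind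
  have h' : B (e 0) (e 5) = 0 := by grind
  have h'' : B (e 2) (e 5) = 0 := by grind
  intro i hi j hj
  interval_cases i <;> interval_cases j <;> grind

/-- `m + 2` lines in `P^(m+2)` imposing independent conditions on the quadrics that contain
the span of `e 0, …, e (m-1)`. -/
lemma exists_pairs_extending (f₁ f₂ f₃ : V) (e : ℕ → V) (m : ℕ) (hm : 1 ≤ m) :
    ∃ l : List (V × V), l.length = m + 2 ∧
      ∀ B : V →ₗ[k] V →ₗ[k] k, (∀ x y, B x y = B y x) → (∀ p ∈ l, VanishesOnPair B p) →
        (∀ i < m, ∀ j < m, B (e i) (e j) = 0) →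
        (∀ i < m, B (e i) f₁ = 0 ∧ B (e i) f₂ = 0 ∧ B (e i) f₃ = 0) ∧
          B f₁ f₁ = 0 ∧ B f₁ f₂ = 0 ∧ B f₁ f₃ = 0 ∧ B f₂ f₂ = 0 ∧ B f₂ f₃ = 0 ∧ B f₃ f₃ = 0 := by
  induction m using Nat.strong_induction_on with
  | _ m ih =>
    obtain rfl | rfl | hm3 : m = 1 ∨ m = 2 ∨ 3 ≤ m := by omega
    · refine ⟨[(f₁, f₂), (f₃, f₁ + e 0), (f₂ + e 0, f₁ + f₃)], rfl, fun B hB hl he => ?_⟩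
      simp only [List.forall_mem_cons] at hl
      have := vanish_of_three_pairs B hB (e 0) f₁ f₂ f₃ (he 0 one_pos 0 one_pos)
        hl.1 hl.2.1 hl.2.2.1
      refine ⟨fun i hi => ?_, this.2⟩
      obtain rfl : i = 0 := by omega
      exact this.1
    · refine ⟨[(f₁, f₂), (f₃, f₁ + e 0), (f₂ + e 0, f₃ + e 1), (f₁ + e 1, f₂ + f₃)], rfl,
        fun B hB hl he => ?_⟩
      simp only [List.forall_mem_cons] at hl
      have := vanish_of_four_pairs B hB (e 0) (e 1) f₁ f₂ f₃ (he 0 two_pos 0 two_pos)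
        (he 0 two_pos 1 one_lt_two) (he 1 one_lt_two 1 one_lt_two)
        hl.1 hl.2.1 hl.2.2.1 hl.2.2.2.1
      refine ⟨fun i hi => ?_, this.2.2⟩
      obtain rfl | rfl : i = 0 ∨ i = 1 := by omega
      exacts [this.1, this.2.1]
    · obtain ⟨m, rfl⟩ : ∃ a, m = a + 2 := ⟨m - 2, by omega⟩
      obtain ⟨l, hlen, hl⟩ := ih m (by omega) (by omega)
      refine ⟨(e m + f₁, e (m + 1) + f₂) :: (e (m + 1) + f₁, e m + f₃) :: l, by simp [hlen],
        fun B hB hp he => ?_⟩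
      simp only [List.forall_mem_cons] at hp
      have h := hl B hB hp.2.2 fun i hi j hj => he i (by omega) j (by omega)
      have h' := vanish_of_two_pairs B hB (e m) (e (m + 1)) f₁ f₂ f₃
        (he _ (by omega) _ (by omega)) (he _ (by omega) _ (by omega))
        (he _ (by omega) _ (by omega)) h.2 hp.1 hp.2.1
      refine ⟨fun i hi => ?_, h.2⟩
      obtain hi | rfl | rfl : i < m ∨ i = m ∨ i = m + 1 := by omega
      exacts [h.1 i hi, h'.1, h'.2]

/-- For `m ≠ 3`, a list of lines in `P^(m-1)` imposing the maximal number of independent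
conditions on quadrics; if `3` does not divide the dimension of the space of quadrics, one
further point is needed to leave no quadric. -/
lemma exists_pairs_vanishing (e : ℕ → V) (m : ℕ) (hm : 1 ≤ m) (hm3 : m ≠ 3) :
    ∃ l : List (V × V),
      3 * l.length + (if m % 3 = 1 then 1 else 0) = (m + 1).choose 2 ∧
      ∀ B : V →ₗ[k] V →ₗ[k] k, (∀ x y, B x y = B y x) → (∀ p ∈ l, VanishesOnPair B p) →
        (m % 3 = 1 → B (e 0) (e 0) = 0) → ∀ i < m, ∀ j < m, B (e i) (e j) = 0 := by
  induction m using Nat.strong_induction_on with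
  | _ m ih =>
    obtain rfl | rfl | rfl | h4 : m = 1 ∨ m = 2 ∨ m = 6 ∨ (4 ≤ m ∧ m ≠ 6) := by omega
    · refine ⟨[], rfl, fun B _ _ h i hi j hj => ?_⟩
      obtain rfl : i = 0 := by omega
      obtain rfl : j = 0 := by omega
      exact h rfl
    · refine ⟨[(e 0, e 1)], rfl, fun B hB hl _ i hi j hj => ?_⟩
      simp only [List.forall_mem_cons, VanishesOnPair] at hl
      have := hB (e 1) (e 0)
      interval_cases i <;> interval_cases j <;> grind
    · refine ⟨[(e 0, e 1), (e 2, e 3), (e 4, e 5), (e 0 + e 2, e 1 + e 3), (e 0 + e 4, e 1 + e 5),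
        (e 2 + e 4, e 3 + e 5), (e 0 + e 2 + e 5, e 1 - e 3 + e 4)], rfl, fun B hB hl _ => ?_⟩
      simp only [List.forall_mem_cons] at hl
      exact vanish_of_seven_pairs B hB e hl.1 hl.2.1 hl.2.2.1 hl.2.2.2.1 hl.2.2.2.2.1
        hl.2.2.2.2.2.1 hl.2.2.2.2.2.2.1
    · obtain ⟨m, rfl⟩ : ∃ a, m = a + 3 := ⟨m - 3, by omega⟩
      obtain ⟨l, hlen, hl⟩ := ih m (by omega) (by omega) (by omega)
      obtain ⟨l', hlen', hl'⟩ := exists_pairs_extending (k := k) (e m) (e (m + 1)) (e (m + 2)) e m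
        (by omega)
      have hmod : (m + 3) % 3 = m % 3 := Nat.add_mod_right m 3
      refine ⟨l' ++ l, ?_, fun B hB hp h0 => ?_⟩
      · have h : ∀ a : ℕ, (a + 1).choose 2 = a.choose 2 + a := fun a => by
          rw [Nat.choose_succ_succ' a 1, Nat.choose_one_right, add_comm]
        rw [hmod, List.length_append, hlen', h, h (m + 2), h (m + 1), ← hlen]
        omega
      · rw [hmod] at h0
        simp only [List.mem_append] at hp
        have h₁ := hl B hB (fun p h => hp p (Or.inr h)) h0
        have h₂ := hl' B hB (fun p h => hp p (Or.inl h)) h₁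
        intro i hi j hj
        have hi' : i < m ∨ i = m ∨ i = m + 1 ∨ i = m + 2 := by omega
        have hj' : j < m ∨ j = m ∨ j = m + 1 ∨ j = m + 2 := by omega
        rcases hi' with hi' | rfl | rfl | rfl <;> rcases hj' with hj' | rfl | rfl | rfl <;> grind

end Pairs

section Quadrics

variable {k : Type*} [Field k]

/-- The symmetric bilinear form with Gram matrix `A`. -/
noncomputable def symForm (k : Type*) [Field k] (m : ℕ) :
    (Sym2 (Fin m) → k) →ₗ[k] (Fin m → k) →ₗ[k] (Fin m → k) →ₗ[k] k where
  toFun A := Matrix.toLinearMap₂' k (Matrix.of fun i j => A s(i, j))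
  map_add' A A' := by rw [← map_add]; rfl
  map_smul' c A := by rw [← map_smul]; rfl

lemma symForm_apply {m : ℕ} (A : Sym2 (Fin m) → k) (x y : Fin m → k) :
    symForm k m A x y = ∑ i, ∑ j, A s(i, j) * (x i * y j) := by
  simp only [symForm, LinearMap.coe_mk, AddHom.coe_mk, Matrix.toLinearMap₂'_apply, smul_eq_mul,
    Matrix.of_apply]
  exact Finset.sum_congr rfl fun i _ => Finset.sum_congr rfl fun j _ => by ring

lemma symForm_comm {m : ℕ} (A : Sym2 (Fin m) → k) (x y : Fin m → k) :
    symForm k m A x y = symForm k m A y x := by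
  rw [symForm_apply, symForm_apply, Finset.sum_comm]
  exact Finset.sum_congr rfl fun i _ => Finset.sum_congr rfl fun j _ => by
    rw [Sym2.eq_swap, mul_comm (x j)]

@[simp] lemma symForm_single {m : ℕ} (A : Sym2 (Fin m) → k) (i j : Fin m) :
    symForm k m A (Pi.single i 1) (Pi.single j 1) = A s(i, j) := by
  simp [symForm_apply, Pi.single_apply]

/-- The three coefficients of the restriction of the quadric `A` to the line spanned by `p`. -/
noncomputable def restrictToPair {m : ℕ} (p : (Fin m → k) × (Fin m → k)) :
    (Sym2 (Fin m) → k) →ₗ[k] k × k × k :=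
  LinearMap.prod ((symForm k m).flip p.1 |>.flip p.1) <|
    LinearMap.prod ((symForm k m).flip p.1 |>.flip p.2) ((symForm k m).flip p.2 |>.flip p.2)

/-- The restrictions of quadrics to a family of lines. -/
noncomputable def restrictToPairs {m s : ℕ} (p : Fin s → (Fin m → k) × (Fin m → k)) :
    (Sym2 (Fin m) → k) →ₗ[k] Fin s → k × k × k :=
  LinearMap.pi fun i => restrictToPair (p i)

lemma restrictToPair_apply {m : ℕ} (p : (Fin m → k) × (Fin m → k)) (A : Sym2 (Fin m) → k) :
    restrictToPair p A =
      (symForm k m A p.1 p.1, symForm k m A p.1 p.2, symForm k m A p.2 p.2) :=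
  rfl

lemma restrictToPair_eq_zero_iff {m : ℕ} (p : (Fin m → k) × (Fin m → k))
    (A : Sym2 (Fin m) → k) : restrictToPair p A = 0 ↔ VanishesOnPair (symForm k m A) p := by
  simp [restrictToPair_apply, VanishesOnPair, Prod.ext_iff]

lemma mem_ker_restrictToPairs {m s : ℕ} (p : Fin s → (Fin m → k) × (Fin m → k))
    (A : Sym2 (Fin m) → k) :
    A ∈ (restrictToPairs p).ker ↔ ∀ i, VanishesOnPair (symForm k m A) (p i) := by
  simp [restrictToPairs, funext_iff, restrictToPair_eq_zero_iff]

lemma linearIndependent_of_surjective {m : ℕ} (p : (Fin m → k) × (Fin m → k))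
    (h : Function.Surjective (restrictToPair p)) : LinearIndependent k ![p.1, p.2] := by
  obtain ⟨A, hA⟩ := h (0, 1, 0)
  simp only [restrictToPair_apply, Prod.mk.injEq] at hA
  rw [LinearIndependent.pair_iff]
  intro a b hab
  have h₁ := congrArg (symForm k m A p.1) hab
  have h₂ := congrArg (symForm k m A p.2) hab
  simp only [map_add, map_smul, map_zero, smul_eq_mul, hA, symForm_comm A p.2 p.1] at h₁ h₂
  exact ⟨by simpa using h₂, by simpa using h₁⟩

lemma finrank_quadrics (m : ℕ) :
    Module.finrank k (Sym2 (Fin m) → k) = (m + 1).choose 2 := by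
  rw [Module.finrank_fintype_fun_eq_card, Sym2.card, Fintype.card_fin]

lemma finrank_pi_prod (t : ℕ) : Module.finrank k (Fin t → k × k × k) = 3 * t := by
  simp [Module.finrank_pi_fintype, mul_comm]

lemma finrank_ker_of_surjective {m s : ℕ} (p : Fin s → (Fin m → k) × (Fin m → k))
    (h : Function.Surjective (restrictToPairs p)) :
    Module.finrank k (restrictToPairs p).ker = (m + 1).choose 2 - 3 * s := by
  have := (restrictToPairs p).finrank_range_add_finrank_ker
  rw [LinearMap.range_eq_top.2 h, finrank_top, finrank_pi_prod, finrank_quadrics] at this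
  omega

lemma surjective_restrictToPairs_castLE {m s t : ℕ} (hst : s ≤ t)
    (p : Fin t → (Fin m → k) × (Fin m → k)) (h : Function.Surjective (restrictToPairs p)) :
    Function.Surjective (restrictToPairs fun i : Fin s => p (i.castLE hst)) := by
  intro y
  obtain ⟨A, hA⟩ := h fun i => if hi : i.1 < s then y ⟨i, hi⟩ else 0
  refine ⟨A, funext fun i => ?_⟩
  exact (congrFun hA (i.castLE hst)).trans (dif_pos i.2)

lemma linearIndependent_single {m : ℕ} {i j : Fin m} (h : i ≠ j) :
    LinearIndependent k ![(Pi.single i 1 : Fin m → k), Pi.single j 1] := by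
  rw [LinearIndependent.pair_iff]
  intro a b hab
  have h₁ := congrFun hab i
  have h₂ := congrFun hab j
  simp [h, h.symm] at h₁ h₂
  exact ⟨h₁, h₂⟩

lemma surjective_restrictToPair_single {m : ℕ} {i j : Fin m} (h : i ≠ j) :
    Function.Surjective (restrictToPair ((Pi.single i 1 : Fin m → k), Pi.single j 1)) := by
  rintro ⟨a, b, c⟩
  refine ⟨fun z => if z = s(i, i) then a else if z = s(i, j) then b else c, ?_⟩
  simp [restrictToPair_apply, h.symm]

lemma ker_restrictToPairs_eq_bot {m s : ℕ} (p : Fin s → (Fin m → k) × (Fin m → k))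
    (h : ∀ A : Sym2 (Fin m) → k, (∀ i, VanishesOnPair (symForm k m A) (p i)) →
      ∀ i j, A s(i, j) = 0) : (restrictToPairs p).ker = ⊥ := by
  rw [Submodule.eq_bot_iff]
  intro A hA
  rw [mem_ker_restrictToPairs] at hA
  funext z
  induction z with
  | _ i j => exact h A hA i j

lemma exists_pairs_finrank_ker [CharZero k] {m s : ℕ} (hm : 2 ≤ m) (hm3 : m ≠ 3) :
    ∃ p : Fin s → (Fin m → k) × (Fin m → k),
      (∀ i, LinearIndependent k ![(p i).1, (p i).2]) ∧
      Module.finrank k (restrictToPairs p).ker = (m + 1).choose 2 - 3 * s := by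
  set e : ℕ → Fin m → k := fun i => if h : i < m then Pi.single ⟨i, h⟩ 1 else 0 with he
  obtain ⟨l, hlen, hl⟩ := exists_pairs_vanishing (k := k) e m (by omega) hm3
  set i₀ : Fin m := ⟨0, by omega⟩
  set i₁ : Fin m := ⟨1, by omega⟩
  have he₀ : e 0 = Pi.single i₀ 1 := by simp only [he]; rw [dif_pos]
  have h01 : i₀ ≠ i₁ := by simp [i₀, i₁]
  have hzero : ∀ A : Sym2 (Fin m) → k, (∀ i, VanishesOnPair (symForm k m A) (l.get i)) →
      (m % 3 = 1 → A s(i₀, i₀) = 0) → ∀ i j, A s(i, j) = 0 := by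
    intro A hA h0 i j
    have := hl (symForm k m A) (symForm_comm A) (List.forall_mem_iff_get.2 hA)
      (by simpa [he₀] using h0) i i.2 j j.2
    simpa [he] using this
  have hsurj : Function.Surjective (restrictToPairs l.get) := by
    by_cases hr : m % 3 = 1
    · have hinj : Function.Injective ((restrictToPairs l.get).prod
          (LinearMap.proj s(i₀, i₀) : (Sym2 (Fin m) → k) →ₗ[k] k)) := by
        rw [← LinearMap.ker_eq_bot, Submodule.eq_bot_iff]
        intro A hA
        rw [LinearMap.ker_prod, Submodule.mem_inf, mem_ker_restrictToPairs] at hA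
        funext z
        induction z with
        | _ i j => exact hzero A hA.1 (fun _ => hA.2) i j
      rw [LinearMap.injective_iff_surjective_of_finrank_eq_finrank (by
        rw [Module.finrank_prod, finrank_pi_prod, finrank_quadrics, Module.finrank_self, ← hlen,
          if_pos hr])] at hinj
      intro y
      obtain ⟨A, hA⟩ := hinj (y, 0)
      exact ⟨A, congrArg Prod.fst hA⟩
    · rw [← LinearMap.injective_iff_surjective_of_finrank_eq_finrank (by
        rw [finrank_pi_prod, finrank_quadrics, ← hlen, if_neg hr, add_zero]),
        ← LinearMap.ker_eq_bot]
      exact ker_restrictToPairs_eq_bot _ fun A hA => hzero A hA fun h => absurd h hr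
  obtain hs | hs := le_or_gt s l.length
  · refine ⟨fun i => l.get (i.castLE hs), fun i => linearIndependent_of_surjective _ fun y => ?_,
      finrank_ker_of_surjective _ (surjective_restrictToPairs_castLE hs _ hsurj)⟩
    obtain ⟨A, hA⟩ := hsurj fun _ => y
    exact ⟨A, congrFun hA _⟩
  · refine ⟨fun i => if h : i.1 < l.length then l.get ⟨i, h⟩ else
      (Pi.single i₀ 1, Pi.single i₁ 1), fun i => ?_, ?_⟩
    · by_cases h : i.1 < l.length
      · simp only [dif_pos h]
        refine linearIndependent_of_surjective _ fun y => ?_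
        obtain ⟨A, hA⟩ := hsurj fun _ => y
        exact ⟨A, congrFun hA _⟩
      · simp only [dif_neg h]
        exact linearIndependent_single h01
    · rw [ker_restrictToPairs_eq_bot, finrank_bot]
      · split_ifs at hlen <;> omega
      · intro A hA
        refine hzero A (fun i => ?_) fun _ => ?_
        · simpa using hA (i.castLE hs.le)
        · simpa using (hA ⟨l.length, hs⟩).1

lemma exists_pairs_finrank_ker_three {s : ℕ} (hs : 1 ≤ s) :
    ∃ p : Fin s → (Fin 3 → k) × (Fin 3 → k),
      (∀ i, LinearIndependent k ![(p i).1, (p i).2]) ∧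
      Module.finrank k (restrictToPairs p).ker =
        if s = 2 then 1 else (3 + 1).choose 2 - 3 * s := by
  set q : ℕ → (Fin 3 → k) × (Fin 3 → k) := fun i =>
    if i = 0 then (Pi.single 0 1, Pi.single 1 1)
    else if i = 1 then (Pi.single 0 1, Pi.single 2 1) else (Pi.single 1 1, Pi.single 2 1) with hq
  have hind : ∀ i, LinearIndependent k ![(q i).1, (q i).2] := by
    intro i
    simp only [hq]
    split_ifs <;> exact linearIndependent_single (by decide)
  refine ⟨fun i => q i, fun i => hind i, ?_⟩
  obtain rfl | rfl | hs3 : s = 1 ∨ s = 2 ∨ 3 ≤ s := by omega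
  · rw [finrank_ker_of_surjective, if_neg (by decide)]
    intro y
    obtain ⟨A, hA⟩ := surjective_restrictToPair_single (k := k) (i := (0 : Fin 3)) (j := 1)
      (by decide) (y 0)
    refine ⟨A, funext fun i => ?_⟩
    obtain rfl : i = 0 := Subsingleton.elim _ _
    exact hA
  · have hker : (restrictToPairs fun i : Fin 2 => q i).ker =
        Submodule.span k {(Pi.single s(1, 2) 1 : Sym2 (Fin 3) → k)} := by
      ext A
      rw [mem_ker_restrictToPairs, Submodule.mem_span_singleton, Fin.forall_fin_two]
      simp only [hq, VanishesOnPair, Fin.val_zero, Fin.val_one, if_true, if_false, one_ne_zero,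
        symForm_single]
      constructor
      · rintro ⟨⟨h00, h01, h11⟩, -, h02, h22⟩
        refine ⟨A s(1, 2), funext fun z => ?_⟩
        induction z with
        | _ i j =>
          have h10 : A s(1, 0) = 0 := by rwa [Sym2.eq_swap]
          have h20 : A s(2, 0) = 0 := by rwa [Sym2.eq_swap]
          have h21 : A s(2, 1) = A s(1, 2) := by rw [Sym2.eq_swap]
          fin_cases i <;> fin_cases j <;> simp [Pi.single_apply, *]
      · rintro ⟨a, rfl⟩
        simp
    rw [hker, if_pos rfl, finrank_span_singleton]
    intro h
    simpa using congrFun h s(1, 2)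
  · rw [ker_restrictToPairs_eq_bot, finrank_bot, if_neg (by omega)]
    · simp [Nat.choose]; omega
    · intro A hA i j
      have h0 := hA ⟨0, by omega⟩
      have h1 := hA ⟨1, by omega⟩
      have h2 := hA ⟨2, by omega⟩
      simp [hq, VanishesOnPair] at h0 h1 h2
      have h10 : A s(1, 0) = 0 := by rw [Sym2.eq_swap]; exact h0.2.1
      have h20 : A s(2, 0) = 0 := by rw [Sym2.eq_swap]; exact h1.2.1
      have h21 : A s(2, 1) = 0 := by rw [Sym2.eq_swap]; exact h2.2.1
      fin_cases i <;> fin_cases j <;> simp [*]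

end Quadrics

section Lift

variable {k : Type*} [Field k]

lemma finite_pencil_scalars {V : Type*} [AddCommGroup V] [Module k V] (p q : V × V)
    (hp : LinearIndependent k ![p.1, p.2]) :
    {c : k | ∃ w : k × k, w ≠ 0 ∧ c • (w.1 • p.1 + w.2 • p.2) = w.1 • q.1 + w.2 • q.2}.Finite := by
  let U : V × V → (k × k) →ₗ[k] V := fun p =>
    LinearMap.coprod (LinearMap.toSpanSingleton k V p.1) (LinearMap.toSpanSingleton k V p.2)
  have hU : ∀ p w, U p w = w.1 • p.1 + w.2 • p.2 := fun _ _ => rfl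
  obtain ⟨R, hR⟩ := (U p).exists_leftInverse_of_injective (by
    rw [Submodule.eq_bot_iff]
    intro w hw
    have := LinearIndependent.pair_iff.1 hp w.1 w.2 hw
    exact Prod.ext this.1 this.2)
  refine (Module.End.finite_hasEigenvalue (R ∘ₗ U q)).subset ?_
  rintro c ⟨w, hw, h⟩
  refine Module.End.hasEigenvalue_of_hasEigenvector (x := w)
    ⟨Module.End.mem_eigenspace_iff.2 ?_, hw⟩
  have := congrArg R h
  rw [← hU, ← hU, map_smul] at this
  rw [LinearMap.comp_apply, ← this, ← LinearMap.comp_apply, hR, LinearMap.id_apply]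

/-- Scalars for which the graphs of the scaled pairs are pairwise disjoint. -/
lemma exists_scalars_disjoint [Infinite k] {V : Type*} [AddCommGroup V] [Module k V] {s : ℕ}
    (p : Fin s → V × V) (hp : ∀ i, LinearIndependent k ![(p i).1, (p i).2]) :
    ∃ c : Fin s → k, ∀ i j, i ≠ j → ∀ a b a' b' : k,
      c i * a = c j * a' → c i * b = c j * b' →
      a • (p i).1 + b • (p i).2 = a' • (p j).1 + b' • (p j).2 → a' = 0 ∧ b' = 0 := by
  let E : Fin s → Fin s → Set k := fun i j => {c : k | ∃ w : k × k, w ≠ 0 ∧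
    c • (w.1 • (p i).1 + w.2 • (p i).2) = w.1 • (p j).1 + w.2 • (p j).2}
  have hfin : ({0} ∪ ⋃ i : Fin s, ⋃ j : Fin s,
      {t : k | i < j ∧ t ^ (j.1 - i.1) ∈ E i j}).Finite := by
    refine (Set.finite_singleton _).union (Set.finite_iUnion fun i => Set.finite_iUnion fun j => ?_)
    by_cases hij : i < j
    · refine ((finite_pencil_scalars (p i) (p j) (hp i)).biUnion
        (t := fun c => {t : k | t ^ (j.1 - i.1) = c}) fun c _ => ?_).subset ?_
      · classical
        refine (Polynomial.nthRoots (j.1 - i.1) c).toFinset.finite_toSet.subset fun t ht => ?_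
        simpa [Polynomial.mem_nthRoots (Nat.sub_pos_of_lt hij)] using ht
      · rintro t ⟨-, ht⟩
        exact Set.mem_biUnion ht rfl
    · simp [hij]
  obtain ⟨t, ht⟩ := hfin.exists_notMem
  simp only [Set.mem_union, Set.mem_singleton_iff, Set.mem_iUnion, Set.mem_ofPred_eq, not_or,
    not_exists, not_and] at ht
  obtain ⟨ht0, ht⟩ := ht
  have key : ∀ i j : Fin s, i < j → ∀ a b a' b' : k,
      t ^ i.1 * a = t ^ j.1 * a' → t ^ i.1 * b = t ^ j.1 * b' →
      a • (p i).1 + b • (p i).2 = a' • (p j).1 + b' • (p j).2 → a' = 0 ∧ b' = 0 := by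
    intro i j hij a b a' b' ha hb h
    have hpow : t ^ j.1 = t ^ i.1 * t ^ (j.1 - i.1) := by
      rw [← pow_add, Nat.add_sub_cancel' hij.le]
    rw [hpow, mul_assoc] at ha hb
    have ha := mul_left_cancel₀ (pow_ne_zero _ ht0) ha
    have hb := mul_left_cancel₀ (pow_ne_zero _ ht0) hb
    subst ha hb
    by_contra hne
    refine ht i j hij ⟨(a', b'), fun h => hne (by simpa using h), ?_⟩
    rw [← h]
    simp only [smul_add, smul_smul]
  refine ⟨fun i => t ^ i.1, fun i j hij a b a' b' ha hb h => ?_⟩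
  obtain hlt | hlt := lt_or_gt_of_ne hij
  · exact key i j hlt a b a' b' ha hb h
  · obtain ⟨rfl, rfl⟩ := key j i hlt a' b' a b ha.symm hb.symm h.symm
    simpa [ht0] using And.intro ha.symm hb.symm

end Lift

section Polynomials

variable {k : Type*} [Field k] {m : ℕ}

/-- The line of `P^(m+1)` on which all but the first two coordinates vanish. -/
def axisLine (k : Type*) [Field k] (m : ℕ) : Submodule k (Fin (m + 1 + 1) → k) where
  carrier := {x | ∀ i : Fin m, x i.succ.succ = 0}
  add_mem' hx hy i := by simp [hx i, hy i]
  zero_mem' _ := rfl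
  smul_mem' c x hx i := by simp [hx i]

/-- The line projecting onto the line spanned by `p`, in the position given by `c`. -/
def liftedLine (c : k) (p : (Fin m → k) × (Fin m → k)) : Submodule k (Fin (m + 1 + 1) → k) :=
  Submodule.span k {Matrix.vecCons c (Matrix.vecCons 0 p.1),
    Matrix.vecCons 0 (Matrix.vecCons c p.2)}

lemma mem_liftedLine {c : k} {p : (Fin m → k) × (Fin m → k)} {x : Fin (m + 1 + 1) → k} :
    x ∈ liftedLine c p ↔ ∃ a b : k,
      x = Matrix.vecCons (c * a) (Matrix.vecCons (c * b) (a • p.1 + b • p.2)) := by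
  rw [liftedLine, Submodule.mem_span_pair]
  refine exists₂_congr fun a b => ?_
  rw [eq_comm]
  simp [mul_comm]

lemma finrank_axisLine : Module.finrank k (axisLine k m) = 2 := by
  have h : axisLine k m = Submodule.span k
      (Set.range ![(Pi.single 0 1 : Fin (m + 1 + 1) → k), Pi.single 1 1]) := by
    ext x
    rw [Matrix.range_cons, Matrix.range_cons, Matrix.range_empty, Set.union_empty,
      Set.singleton_union, Submodule.mem_span_pair]
    constructor
    · intro hx
      refine ⟨x 0, x 1, funext fun i => ?_⟩
      refine Fin.cases ?_ (fun i => Fin.cases ?_ (fun i => ?_) i) i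
      · simp
      · simp
      · simp [hx i, Fin.ext_iff]
    · rintro ⟨a, b, rfl⟩ i
      simp [Fin.ext_iff]
  rw [h, finrank_span_eq_card (linearIndependent_single (by simp)), Fintype.card_fin]

lemma finrank_liftedLine {c : k} {p : (Fin m → k) × (Fin m → k)}
    (hp : LinearIndependent k ![p.1, p.2]) : Module.finrank k (liftedLine c p) = 2 := by
  have hli : LinearIndependent k ![(Matrix.vecCons c (Matrix.vecCons 0 p.1) :
      Fin (m + 1 + 1) → k), Matrix.vecCons 0 (Matrix.vecCons c p.2)] := by
    rw [LinearIndependent.pair_iff] at hp ⊢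
    intro a b hab
    refine hp a b (funext fun i => ?_)
    simpa using congrFun hab i.succ.succ
  rw [← Fintype.card_fin 2, ← finrank_span_eq_card hli, liftedLine, Matrix.range_cons,
    Matrix.range_cons, Matrix.range_empty, Set.union_empty, Set.singleton_union]

lemma axisLine_inf_liftedLine {c : k} {p : (Fin m → k) × (Fin m → k)}
    (hp : LinearIndependent k ![p.1, p.2]) : axisLine k m ⊓ liftedLine c p = ⊥ := by
  rw [Submodule.eq_bot_iff]
  rintro x ⟨hx, hx'⟩
  obtain ⟨a, b, rfl⟩ := mem_liftedLine.1 hx'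
  obtain ⟨rfl, rfl⟩ := LinearIndependent.pair_iff.1 hp a b (funext fun i => by simpa using hx i)
  simp

/-- The quadratic polynomial with Gram matrix `A` in all but the first two variables. -/
noncomputable def quadricPoly (k : Type*) [Field k] (m : ℕ) :
    (Sym2 (Fin m) → k) →ₗ[k] MvPolynomial (Fin (m + 1 + 1)) k where
  toFun A := ∑ i : Fin m, ∑ j : Fin m, A s(i, j) • (X i.succ.succ * X j.succ.succ)
  map_add' A A' := by simp [add_smul, Finset.sum_add_distrib]
  map_smul' c A := by simp [mul_smul, Finset.smul_sum]

lemma quadricPoly_apply (A : Sym2 (Fin m) → k) :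
    quadricPoly k m A =
      ∑ i : Fin m, ∑ j : Fin m, A s(i, j) • (X i.succ.succ * X j.succ.succ) :=
  rfl

lemma eval_quadricPoly (A : Sym2 (Fin m) → k) (x : Fin (m + 1 + 1) → k) :
    eval x (quadricPoly k m A) =
      symForm k m A (fun i => x i.succ.succ) fun i => x i.succ.succ := by
  simp [quadricPoly_apply, symForm_apply, smul_eval]

lemma quadricPoly_injective [CharZero k] : Function.Injective (quadricPoly k m) := by
  rw [← LinearMap.ker_eq_bot, Submodule.eq_bot_iff]
  intro A hA
  rw [LinearMap.mem_ker] at hA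
  have h : ∀ y : Fin m → k, symForm k m A y y = 0 := fun y => by
    have := eval_quadricPoly A (Matrix.vecCons 0 (Matrix.vecCons 0 y))
    rw [hA, map_zero] at this
    simpa using this.symm
  funext z
  induction z with
  | _ i j =>
    have hij := h (Pi.single i 1 + Pi.single j 1)
    simp only [map_add, LinearMap.add_apply, h, symForm_single, Sym2.eq_swap (a := j)] at hij
    have hii := h (Pi.single i 1)
    have hjj := h (Pi.single j 1)
    simpa using hij

lemma mem_subspaceIdeal {n : ℕ} {W : Submodule k (Fin n → k)} {P : MvPolynomial (Fin n) k} :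
    P ∈ subspaceIdeal k n W ↔ ∀ x ∈ W, eval x P = 0 := by
  simp only [subspaceIdeal, RingHom.mem_ker, funext_iff, Subtype.forall]
  rfl

lemma pderiv_mem_of_mem_sq {σ : Type*} {I : Ideal (MvPolynomial σ k)} {P : MvPolynomial σ k}
    (hP : P ∈ I ^ 2) (a : σ) : pderiv a P ∈ I := by
  rw [pow_two] at hP
  induction hP using Submodule.mul_induction_on' with
  | mem_mul_mem f hf g hg =>
    rw [Derivation.leibniz]
    exact I.add_mem (Ideal.mul_mem_right _ _ hf) (Ideal.mul_mem_right _ _ hg)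
  | add f _ g _ hf hg => rw [map_add]; exact I.add_mem hf hg

lemma exists_gram_of_isHomogeneous [CharZero k] {n : ℕ} {P : MvPolynomial (Fin n) k}
    (hP : P ∈ homogeneousSubmodule (Fin n) k 2) :
    ∃ C : Sym2 (Fin n) → k, P = ∑ i, ∑ j, C s(i, j) • (X i * X j) := by
  have hmem : P ∈ LinearMap.range (Fintype.linearCombination k
      fun z : Fin n × Fin n => (X z.1 * X z.2 : MvPolynomial (Fin n) k)) := by
    rw [← homogeneousSubmodule_one_pow, homogeneousSubmodule_one_eq_span_X, pow_two,
      Submodule.span_mul_span] at hP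
    refine Submodule.span_le.2 ?_ hP
    rintro _ ⟨_, ⟨i, rfl⟩, _, ⟨j, rfl⟩, rfl⟩
    rw [Fintype.range_linearCombination]
    exact Submodule.subset_span ⟨(i, j), rfl⟩
  obtain ⟨c, rfl⟩ := hmem
  refine ⟨Sym2.lift ⟨fun i j => 2⁻¹ * (c (i, j) + c (j, i)), fun _ _ => congrArg _ (add_comm _ _)⟩, ?_⟩
  have hswap : ∑ i, ∑ j, c (j, i) • (X i * X j : MvPolynomial (Fin n) k) =
      ∑ i, ∑ j, c (i, j) • (X i * X j) := by
    rw [Finset.sum_comm]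
    exact Finset.sum_congr rfl fun i _ => Finset.sum_congr rfl fun j _ => by rw [mul_comm (X j)]
  simp only [Fintype.linearCombination_apply, Fintype.sum_prod_type, Sym2.lift_mk, mul_smul,
    add_smul, ← Finset.smul_sum, Finset.sum_add_distrib, hswap]
  rw [← two_smul k, smul_smul, inv_mul_cancel₀ two_ne_zero, one_smul]

lemma eval_pderiv_gram {n : ℕ} (C : Sym2 (Fin n) → k) (a b : Fin n) :
    eval (Pi.single b 1) (pderiv a (∑ i, ∑ j, C s(i, j) • (X i * X j : MvPolynomial (Fin n) k)))
      = 2 * C s(a, b) := by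
  simp only [map_sum, Derivation.map_smul, Derivation.leibniz, pderiv_X, smul_eval, map_add,
    smul_eq_mul, map_mul, eval_X, Pi.single_apply, apply_ite (eval _), map_one, map_zero]
  simp [mul_add, Finset.sum_add_distrib, Sym2.eq_swap (a := b), two_mul]

/-- The quadrics in the ideal of the scheme `X` are the cones over the quadrics through the
projections of the lines from the double line. -/
lemma sq_inf_iInf_inf_homogeneous [CharZero k] {s : ℕ} (c : Fin s → k)
    (p : Fin s → (Fin m → k) × (Fin m → k)) :
    Submodule.restrictScalars k (subspaceIdeal k (m + 1 + 1) (axisLine k m) ^ 2 ⊓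
        ⨅ i, subspaceIdeal k (m + 1 + 1) (liftedLine (c i) (p i))) ⊓
      homogeneousSubmodule (Fin (m + 1 + 1)) k 2 =
      (restrictToPairs p).ker.map (quadricPoly k m) := by
  ext P
  simp only [Submodule.mem_inf, Submodule.restrictScalars_mem, Submodule.mem_iInf,
    Submodule.mem_map, mem_ker_restrictToPairs]
  constructor
  · rintro ⟨⟨hsq, hlines⟩, hhom⟩
    obtain ⟨C, rfl⟩ := exists_gram_of_isHomogeneous hhom
    have hC : ∀ a b : Fin (m + 1 + 1), Pi.single b 1 ∈ axisLine k m → C s(a, b) = 0 := by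
      intro a b hb
      have := mem_subspaceIdeal.1 (pderiv_mem_of_mem_sq hsq a) _ hb
      rw [eval_pderiv_gram] at this
      exact (mul_eq_zero.1 this).resolve_left two_ne_zero
    have h0 : ∀ a, C s(a, 0) = 0 := fun a => hC a 0 fun i => by simp
    have h1 : ∀ a, C s(a, Fin.succ 0) = 0 := fun a => hC a _ fun i => by simp [Fin.ext_iff]
    have h0' : ∀ a, C s(0, a) = 0 := fun a => by rw [Sym2.eq_swap, h0]
    have h1' : ∀ a, C s(Fin.succ 0, a) = 0 := fun a => by rw [Sym2.eq_swap, h1]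
    have hP : quadricPoly k m (C ∘ Sym2.map (Fin.succ ∘ Fin.succ)) =
        ∑ i, ∑ j, C s(i, j) • (X i * X j) := by
      simp only [quadricPoly_apply, Fin.sum_univ_succ (n := m + 1), Fin.sum_univ_succ (n := m),
        h0, h1, h0', h1', zero_smul, Finset.sum_const_zero, zero_add]
      rfl
    refine ⟨_, fun i => ?_, hP⟩
    rw [← hP] at hlines
    generalize C ∘ Sym2.map (Fin.succ ∘ Fin.succ) = A at hlines ⊢
    have hq : ∀ a b : k, symForm k m A
        (a • (p i).1 + b • (p i).2) (a • (p i).1 + b • (p i).2) = 0 := by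
      intro a b
      have := mem_subspaceIdeal.1 (hlines i) _ (mem_liftedLine.2 ⟨a, b, rfl⟩)
      rwa [eval_quadricPoly] at this
    have hu : symForm k m A (p i).1 (p i).1 = 0 := by simpa using hq 1 0
    have hv : symForm k m A (p i).2 (p i).2 = 0 := by simpa using hq 0 1
    refine ⟨hu, ?_, hv⟩
    have huv := hq 1 1
    simp only [one_smul, map_add, LinearMap.add_apply, hu, hv, symForm_comm A (p i).2 (p i).1]
      at huv
    simpa using huv
  · rintro ⟨A, hA, rfl⟩
    refine ⟨⟨?_, fun i => mem_subspaceIdeal.2 fun x hx => ?_⟩, ?_⟩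
    · have hX : ∀ i : Fin m, (X i.succ.succ : MvPolynomial (Fin (m + 1 + 1)) k) ∈
          subspaceIdeal k (m + 1 + 1) (axisLine k m) :=
        fun i => mem_subspaceIdeal.2 fun x hx => by simpa using hx i
      rw [quadricPoly_apply, pow_two]
      exact Ideal.sum_mem _ fun i _ => Ideal.sum_mem _ fun j _ =>
        Submodule.smul_of_tower_mem _ _ (Ideal.mul_mem_mul (hX i) (hX j))
    · obtain ⟨a, b, rfl⟩ := mem_liftedLine.1 hx
      obtain ⟨h₁, h₂, h₃⟩ := hA i
      rw [eval_quadricPoly]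
      change symForm k m A (a • (p i).1 + b • (p i).2) (a • (p i).1 + b • (p i).2) = 0
      simp [h₁, h₂, h₃, symForm_comm A (p i).2 (p i).1]
    · rw [quadricPoly_apply]
      exact Submodule.sum_mem _ fun i _ => Submodule.sum_mem _ fun j _ =>
        Submodule.smul_mem _ _ ((isHomogeneous_X k _).mul (isHomogeneous_X k _))

lemma homIdealDim_eq_finrank_ker [CharZero k] {s : ℕ} (c : Fin s → k)
    (p : Fin s → (Fin m → k) × (Fin m → k)) :
    homIdealDim k (m + 1 + 1) (subspaceIdeal k (m + 1 + 1) (axisLine k m) ^ 2 ⊓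
        ⨅ i, subspaceIdeal k (m + 1 + 1) (liftedLine (c i) (p i))) 2 =
      Module.finrank k (restrictToPairs p).ker := by
  rw [homIdealDim, sq_inf_iInf_inf_homogeneous]
  exact (Submodule.equivMapOfInjective _ quadricPoly_injective _).finrank_eq.symm

end Polynomials

/-- A generic union `X ⊆ P^n` (`n ≥ 3`) of `s ≥ 1` lines and one double line `2L`
has good postulation in degree `2`:
`h^0(I_X(2)) = max {C(n+2,n) - (2n+1) - 3s, 0} = max {C(n,2) - 3s, 0}`,
except in the single case `n = 4, s = 2`, where `h^0(I_X(2)) = 1` instead of the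
expected `0`. Lines in `P^n` are modelled by their affine cones, i.e.
`2`-dimensional linear subspaces of `k^(n+1)`; genericity is expressed by the
existence of a configuration of pairwise disjoint lines realizing the stated value. -/
theorem generic_lines_and_one_double_line_degree_two
    (k : Type*) [Field k] [IsAlgClosed k] [CharZero k]
    (n s : ℕ) (hn : 3 ≤ n) (hs : 1 ≤ s) :
    (∃ (L : Submodule k (Fin (n+1) → k)) (Ls : Fin s → Submodule k (Fin (n+1) → k)),
      Module.finrank k L = 2 ∧
      (∀ i, Module.finrank k (Ls i) = 2) ∧
      (∀ i j, i ≠ j → Ls i ⊓ Ls j = ⊥) ∧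
      (∀ i, L ⊓ Ls i = ⊥) ∧
      (homIdealDim k (n+1)
          ((subspaceIdeal k (n+1) L) ^ 2 ⊓ ⨅ i, subspaceIdeal k (n+1) (Ls i)) 2 : ℤ)
        = if n = 4 ∧ s = 2 then 1
          else max (((n+2).choose n : ℤ) - (2*n+1) - 3*s) 0) ∧
    max (((n+2).choose n : ℤ) - (2*n+1) - 3*s) 0 = max ((n.choose 2 : ℤ) - 3*s) 0 := by
  obtain ⟨m, rfl⟩ : ∃ m, n = m + 1 := ⟨n - 1, by omega⟩
  have hchoose : (m + 1 + 2).choose (m + 1) = (m + 1).choose 2 + (2 * (m + 1) + 1) := by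
    have h : ∀ a : ℕ, (a + 1).choose 2 = a.choose 2 + a := fun a => by
      rw [Nat.choose_succ_succ' a 1, Nat.choose_one_right, add_comm]
    rw [Nat.choose_symm_add, h, h]
    omega
  refine ⟨?_, by rw [hchoose]; push_cast; ring_nf⟩
  obtain ⟨p, hp, hrank⟩ : ∃ p : Fin s → (Fin m → k) × (Fin m → k),
      (∀ i, LinearIndependent k ![(p i).1, (p i).2]) ∧
      Module.finrank k (restrictToPairs p).ker =
        if m = 3 ∧ s = 2 then 1 else (m + 1).choose 2 - 3 * s := by
    by_cases hm3 : m = 3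
    · subst hm3
      simpa using exists_pairs_finrank_ker_three hs
    · simpa [hm3] using exists_pairs_finrank_ker (by omega) hm3
  obtain ⟨c, hc⟩ := exists_scalars_disjoint p hp
  refine ⟨axisLine k m, fun i => liftedLine (c i) (p i), finrank_axisLine,
    fun i => finrank_liftedLine (hp i), fun i j hij => ?_,
    fun i => axisLine_inf_liftedLine (hp i), ?_⟩
  · rw [Submodule.eq_bot_iff]
    rintro x ⟨hi, hj⟩
    obtain ⟨a, b, hx⟩ := mem_liftedLine.1 hi
    obtain ⟨a', b', rfl⟩ := mem_liftedLine.1 hj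
    rw [Matrix.vecCons_inj, Matrix.vecCons_inj] at hx
    obtain ⟨rfl, rfl⟩ := hc i j hij a b a' b' hx.1.symm hx.2.1.symm hx.2.2.symm
    simp
  · rw [homIdealDim_eq_finrank_ker, hrank, hchoose]
    split_ifs <;> omega
end

section
/- Let n, d, r, m be integers with r < n and 1 ≤ m ≤ d. Let Π ⊆ P^n be a linear subspace of dimension r, with saturated homogeneous ideal I(Π) generated by n − r independent linear forms in the polynomial ring S = k[x_0, …, x_n]. Then the k-dimension of the degree-d homogeneous component of S / I(Π)^m equals Σ_{i=0}^{m−1} C(r+d−i, r) · C(n+i−r−1, i); that is, the Hilbert function of the m-multiple linear space mΠ in degree d is HP(mΠ, d) = Σ_{i=0}^{m−1} C(r+d−i, r) C(n+i−r−1, i). -/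
open MvPolynomial

namespace MvPolynomial

open Finsupp in
/-- Membership in a power of the ideal generated by the left block of variables is a condition
on the partial degrees of the monomials. -/
theorem mem_span_range_X_inl_pow_iff {ι κ R : Type*} [Fintype ι] [CommSemiring R] (m : ℕ)
    (p : MvPolynomial (ι ⊕ κ) R) :
    p ∈ Ideal.span (Set.range fun i : ι ↦ (X (Sum.inl i) : MvPolynomial (ι ⊕ κ) R)) ^ m ↔
      ∀ x ∈ p.support, m ≤ ∑ i, x (Sum.inl i) := by
  have hspan : Ideal.span (Set.range fun i : ι ↦ (X (Sum.inl i) : MvPolynomial (ι ⊕ κ) R)) ^ m =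
      Ideal.span ((fun s ↦ monomial s (1 : R)) ''
        (mapDomain Sum.inl '' {y : ι →₀ ℕ | y.degree = m})) := by
    rw [Ideal.span, Submodule.span_pow, ← Set.image_univ, image_pow_eq_finsuppProd_image,
      Set.image_image]
    congr 1
    simp [monomial_eq, prod_mapDomain_index, pow_add]
  rw [hspan, mem_ideal_span_monomial_image]
  refine forall₂_congr fun x _ ↦ ?_
  have hx : ∑ i, x (Sum.inl i) = (x.comapDomain Sum.inl Sum.inl_injective.injOn).degree := by
    simp [degree_eq_sum]
  rw [hx, Set.exists_mem_image]
  constructor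
  · rintro ⟨y, rfl, hyx⟩
    refine degree_mono fun i ↦ ?_
    simpa [mapDomain_apply Sum.inl_injective] using hyx (Sum.inl i)
  · intro h
    obtain ⟨y, hyx, hy⟩ := exists_le_degree_eq _ m h
    refine ⟨y, hy, ?_⟩
    rintro (i | j)
    · simpa [mapDomain_apply Sum.inl_injective] using hyx i
    · rw [mapDomain_of_notMem_range]
      · exact Nat.zero_le _
      · simp

end MvPolynomial

/-- The exponents of total degree `d` on `ι ⊕ κ` having partial degree less than `m` on `ι`. -/
def Finset.finsuppAntidiagInlLT (ι κ : Type*) [Fintype ι] [Fintype κ] [DecidableEq ι]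
    [DecidableEq κ] (d m : ℕ) : Finset (ι ⊕ κ →₀ ℕ) :=
  ((Finset.univ : Finset (ι ⊕ κ)).finsuppAntidiag d).filter fun x ↦ ∑ i, x (Sum.inl i) < m

theorem Finset.card_finsuppAntidiagInlLT (ι κ : Type*) [Fintype ι] [Fintype κ] [DecidableEq ι]
    [DecidableEq κ] (d m : ℕ) (hmd : m ≤ d + 1) :
    (Finset.finsuppAntidiagInlLT ι κ d m).card =
      ∑ i ∈ Finset.range m, (Fintype.card ι + i - 1).choose i *
        (Fintype.card κ + (d - i) - 1).choose (d - i) := by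
  rw [Finset.card_eq_sum_card_fiberwise (f := fun x ↦ ∑ i, x (Sum.inl i)) (t := Finset.range m)
    fun x hx ↦ by simpa using (Finset.mem_filter.mp hx).2]
  refine Finset.sum_congr rfl fun i hi ↦ ?_
  rw [← Finset.card_univ, ← Finset.card_univ, ← Finset.card_finsuppAntidiag_nat_eq_choose,
    ← Finset.card_finsuppAntidiag_nat_eq_choose, ← Finset.card_product]
  refine Finset.card_equiv Finsupp.sumFinsuppEquivProdFinsupp fun x ↦ ?_
  have := Finset.mem_range.mp hi
  simp only [finsuppAntidiagInlLT, Finset.mem_filter, Finset.mem_finsuppAntidiag,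
    Finset.mem_product, Finset.subset_univ, and_true, Fintype.sum_sum_type]
  change _ ↔ ∑ a, x (Sum.inl a) = i ∧ ∑ a, x (Sum.inr a) = d - i
  omega

namespace MvPolynomial

/-- The dimension of the image of the degree-`d` forms under a linear map whose kernel is the
`m`-th power of the ideal of the left block of variables. -/
theorem finrank_map_homogeneousSubmodule_of_ker {ι κ k W : Type*} [Fintype ι] [Fintype κ]
    [DecidableEq ι] [DecidableEq κ] [Field k] [AddCommGroup W] [Module k W] (d m : ℕ)
    (f : MvPolynomial (ι ⊕ κ) k →ₗ[k] W)
    (hf : ∀ p, f p = 0 ↔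
      p ∈ Ideal.span (Set.range fun i : ι ↦ (X (Sum.inl i) : MvPolynomial (ι ⊕ κ) k)) ^ m) :
    Module.finrank k ((homogeneousSubmodule (ι ⊕ κ) k d).map f) =
      (Finset.finsuppAntidiagInlLT ι κ d m).card := by
  let g : MvPolynomial (ι ⊕ κ) k →ₗ[k] (Finset.finsuppAntidiagInlLT ι κ d m → k) :=
    LinearMap.pi fun b ↦ lcoeff k b.1
  let H := homogeneousSubmodule (ι ⊕ κ) k d
  have hmem (x : ι ⊕ κ →₀ ℕ) : x ∈ Finset.finsuppAntidiagInlLT ι κ d m ↔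
      x.degree = d ∧ ∑ i, x (Sum.inl i) < m := by
    simp [Finset.finsuppAntidiagInlLT, Finsupp.degree_eq_sum]
  have hker : LinearMap.ker (f.domRestrict H) = LinearMap.ker (g.domRestrict H) := by
    ext ⟨p, hp⟩
    rw [LinearMap.mem_ker, LinearMap.mem_ker, LinearMap.domRestrict_apply,
      LinearMap.domRestrict_apply, hf, mem_span_range_X_inl_pow_iff]
    constructor
    · intro h
      ext ⟨x, hx⟩
      by_contra hne
      exact absurd (h x (mem_support_iff.mpr hne)) (not_le.mpr ((hmem x).mp hx).2)
    · intro h x hx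
      by_contra hlt
      have hdeg : x.degree = d := by
        by_contra hne
        exact mem_support_iff.mp hx (IsHomogeneous.coeff_eq_zero hp hne)
      exact mem_support_iff.mp hx (congrFun h ⟨x, (hmem x).mpr ⟨hdeg, not_le.mp hlt⟩⟩)
  have hsurj : LinearMap.range (g.domRestrict H) = ⊤ := by
    refine LinearMap.range_eq_top.mpr fun c ↦ ?_
    refine ⟨⟨∑ b, monomial b.1 (c b), Submodule.sum_mem _ fun b _ ↦
      isHomogeneous_monomial _ ((hmem _).mp b.2).1⟩, ?_⟩
    ext b
    simp [g, coeff_monomial]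
  rw [← LinearMap.range_domRestrict, ← (f.domRestrict H).quotKerEquivRange.finrank_eq, hker,
    (g.domRestrict H).quotKerEquivRange.finrank_eq, hsurj]
  simp

/-- A basis of the space of linear forms induces a linear change of coordinates. -/
theorem exists_algEquiv_X_eq_basis {σ τ k : Type*} [Field k]
    (b : Module.Basis σ k (homogeneousSubmodule τ k 1)) :
    ∃ e : MvPolynomial σ k ≃ₐ[k] MvPolynomial τ k, (∀ s, e (X s) = b s) ∧
      ∀ d, (homogeneousSubmodule σ k d).map e.toLinearMap = homogeneousSubmodule τ k d := by
  let L : homogeneousSubmodule τ k 1 →ₗ[k] MvPolynomial σ k := b.constr k X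
  let φ : MvPolynomial σ k →ₐ[k] MvPolynomial τ k := aeval fun s ↦ (b s : MvPolynomial τ k)
  let ψ : MvPolynomial τ k →ₐ[k] MvPolynomial σ k := aeval fun t ↦ L ⟨X t, isHomogeneous_X k t⟩
  have hφL (v : homogeneousSubmodule τ k 1) : φ (L v) = v := by
    have : φ.toLinearMap ∘ₗ L = (homogeneousSubmodule τ k 1).subtype :=
      b.ext fun s ↦ by simp [φ, L]
    exact LinearMap.congr_fun this v
  have hψ (p : MvPolynomial τ k) (hp : p ∈ homogeneousSubmodule τ k 1) : ψ p = L ⟨p, hp⟩ := by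
    have hp' := hp
    rw [homogeneousSubmodule_one_eq_span_X] at hp'
    induction hp' using Submodule.span_induction with
    | mem x h =>
      obtain ⟨t, rfl⟩ := h
      simp [ψ]
    | zero => exact (map_zero ψ).trans (map_zero L).symm
    | add x y hx hy ihx ihy =>
      rw [← homogeneousSubmodule_one_eq_span_X] at hx hy
      rw [map_add, ihx hx, ihy hy, ← map_add]
      rfl
    | smul a x hx ihx =>
      rw [← homogeneousSubmodule_one_eq_span_X] at hx
      rw [map_smul, ihx hx, ← map_smul]
      rfl
  have hL (v : homogeneousSubmodule τ k 1) : (L v).IsHomogeneous 1 := by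
    rw [← b.linearCombination_repr v, Finsupp.linearCombination_apply, Finsupp.sum, map_sum]
    refine Submodule.sum_mem (homogeneousSubmodule σ k 1) fun s _ ↦ ?_
    rw [map_smul]
    exact Submodule.smul_mem _ _ (by simpa [L] using isHomogeneous_X k s)
  have hφψ : φ.comp ψ = AlgHom.id k _ := by
    ext1 t
    simp [ψ, hφL]
  have hψφ : ψ.comp φ = AlgHom.id k _ := by
    ext1 s
    have := hψ (b s) (b s).2
    simp [φ, this, L]
  refine ⟨AlgEquiv.ofAlgHom φ ψ hφψ hψφ, fun s ↦ by simp [φ], fun d ↦ le_antisymm ?_ ?_⟩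
  · rintro _ ⟨p, hp, rfl⟩
    have := IsHomogeneous.aeval (n := 1) hp _ fun s ↦ (b s).2
    rwa [one_mul] at this
  · intro p hp
    refine ⟨ψ p, ?_, AlgHom.congr_fun hφψ p⟩
    have := IsHomogeneous.aeval (n := 1) hp _ fun t ↦ hL ⟨X t, isHomogeneous_X k t⟩
    rwa [one_mul] at this

theorem finrank_homogeneousSubmodule_one (τ k : Type*) [Fintype τ] [Field k] :
    Module.finrank k (homogeneousSubmodule τ k 1) = Fintype.card τ := by
  rw [homogeneousSubmodule_one_eq_span_X]
  exact finrank_span_eq_card (linearIndependent_X τ k)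

end MvPolynomial

/-- A linearly independent family in a finite-dimensional space extends to a basis. -/
theorem LinearIndependent.exists_basis_sum_fin {ι k V : Type*} [Fintype ι] [Field k]
    [AddCommGroup V] [Module k V] [FiniteDimensional k V] {v : ι → V}
    (hv : LinearIndependent k v) (c : ℕ) (hc : Fintype.card ι + c = Module.finrank k V) :
    ∃ b : Module.Basis (ι ⊕ Fin c) k V, ∀ i, b (Sum.inl i) = v i := by
  have hq : Module.finrank k (V ⧸ Submodule.span k (Set.range v)) = c := by
    have := Submodule.finrank_quotient_add_finrank (Submodule.span k (Set.range v))
    rw [finrank_span_eq_card hv] at this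
    omega
  refine ⟨(Module.Basis.span hv).sumQuot (Module.finBasisOfFinrankEq k _ hq), fun i ↦ ?_⟩
  rw [Module.Basis.sumQuot_inl, Module.Basis.span_apply]

/-- Hilbert function of an `m`-multiple linear space: if `Π ⊆ P^n` is an
`r`-dimensional linear subspace (`r < n`) whose saturated homogeneous ideal
`I(Π) ⊆ S = k[x_0, …, x_n]` is generated by `n - r` independent linear forms, and
`1 ≤ m ≤ d`, then the `k`-dimension of the degree-`d` homogeneous component of
`S / I(Π)^m` equals `Σ_{i=0}^{m-1} C(r+d-i, r) · C(n+i-r-1, i)`.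
The degree-`d` component of the quotient is the image of the degree-`d` homogeneous
component of `S` under the quotient map. -/
theorem hilbert_function_of_multiple_linear_space
    (k : Type*) [Field k] (n d r m : ℕ) (hrn : r < n) (hm : 1 ≤ m) (hmd : m ≤ d)
    (ℓ : Fin (n - r) → MvPolynomial (Fin (n+1)) k)
    (hdeg : ∀ j, ℓ j ∈ MvPolynomial.homogeneousSubmodule (Fin (n+1)) k 1)
    (hind : LinearIndependent k ℓ) :
    Module.finrank k
      ↥((MvPolynomial.homogeneousSubmodule (Fin (n+1)) k d).map
          (Ideal.Quotient.mkₐ k ((Ideal.span (Set.range ℓ)) ^ m)).toLinearMap)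
      = ∑ i ∈ Finset.range m, (r + d - i).choose r * (n + i - r - 1).choose i := by
  have hfin : FiniteDimensional k (homogeneousSubmodule (Fin (n + 1)) k 1) :=
    Module.Finite.iff_fg.mpr (homogeneousSubmodule_fg _ k 1)
  have hind' : LinearIndependent k
      fun j ↦ (⟨ℓ j, hdeg j⟩ : homogeneousSubmodule (Fin (n + 1)) k 1) :=
    LinearIndependent.of_comp (homogeneousSubmodule (Fin (n + 1)) k 1).subtype hind
  obtain ⟨b, hb⟩ := hind'.exists_basis_sum_fin (r + 1) (by
    rw [finrank_homogeneousSubmodule_one, Fintype.card_fin, Fintype.card_fin]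
    omega)
  obtain ⟨e, he, hd⟩ := exists_algEquiv_X_eq_basis b
  have hspan : Ideal.span (Set.range ℓ) ^ m = Ideal.map e (Ideal.span (Set.range fun i ↦
      (X (Sum.inl i) : MvPolynomial (Fin (n - r) ⊕ Fin (r + 1)) k)) ^ m) := by
    rw [Ideal.map_pow, Ideal.map_span, ← Set.range_comp]
    congr 3
    ext1 j
    simp [he, hb]
  rw [← hd, ← Submodule.map_comp, finrank_map_homogeneousSubmodule_of_ker d m,
    Finset.card_finsuppAntidiagInlLT _ _ d m (by omega), Fintype.card_fin, Fintype.card_fin]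
  · refine Finset.sum_congr rfl fun i hi ↦ ?_
    have := Finset.mem_range.mp hi
    rw [mul_comm, show n - r + i - 1 = n + i - r - 1 by omega,
      show r + 1 + (d - i) - 1 = r + d - i by omega,
      ← Nat.choose_symm (show d - i ≤ r + d - i by omega),
      show r + d - i - (d - i) = r by omega]
  · intro p
    rw [LinearMap.comp_apply, AlgHom.toLinearMap_apply, Ideal.Quotient.mkₐ_eq_mk,
      Ideal.Quotient.eq_zero_iff_mem, hspan, Ideal.mem_map_of_equiv]
    exact ⟨fun ⟨q, hq, hqp⟩ ↦ e.injective hqp ▸ hq, fun hp ↦ ⟨p, hp, rfl⟩⟩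
end

section
/- Let n, d be integers with either (n ≥ 5 and d ≥ 3) or (n = 4 and d ≥ 5). Define r = ⌊(C(d+n, n) − (nd+1))/(d+1)⌋, q = C(d+n, n) − (nd+1) − r(d+1), r' = ⌊(C(d−1+n, n) − (n(d−1)+1) − q)/d⌋, and q' = C(d−1+n, n) − (n(d−1)+1) − r'd − q. Then r − r' − 2q' ≥ 0. -/
theorem cube_bound_of_choose_four (e : ℕ) (he : 4 ≤ e) :
    (e : ℤ) * (e + 2) * (2 * e + 1) < 3 * (((e + 4).choose 4 : ℤ) - 1) + (e + 1) * (e + 2) := by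
  have h := Nat.ascFactorial_eq_factorial_mul_choose e 4
  simp only [Nat.ascFactorial, Nat.factorial] at h
  zify at h
  obtain ⟨k, rfl⟩ := Nat.exists_eq_add_of_le he
  push_cast at h ⊢
  rcases k with _ | _ | _ | k
  · norm_num at h ⊢
    linarith
  · norm_num at h ⊢
    linarith
  · norm_num at h ⊢
    linarith
  · push_cast at h ⊢
    have hk : (0 : ℤ) ≤ k := by positivity
    nlinarith [pow_nonneg hk 2, pow_nonneg hk 3, pow_nonneg hk 4]

theorem cube_bound_of_choose_five (e : ℕ) (he : 2 ≤ e) :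
    (e : ℤ) * (e + 2) * (2 * e + 1) < 4 * (((e + 5).choose 5 : ℤ) - 1) + (e + 1) * (e + 2) := by
  have h := Nat.ascFactorial_eq_factorial_mul_choose e 5
  simp only [Nat.ascFactorial, Nat.factorial] at h
  zify at h
  obtain ⟨k, rfl⟩ := Nat.exists_eq_add_of_le he
  push_cast at h ⊢
  have hk : (0 : ℤ) ≤ k := by positivity
  nlinarith [pow_nonneg hk 2, pow_nonneg hk 3, pow_nonneg hk 4, pow_nonneg hk 5]

theorem cube_bound_of_choose (n e : ℕ) (h : (5 ≤ n ∧ 2 ≤ e) ∨ (n = 4 ∧ 4 ≤ e)) :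
    (e : ℤ) * (e + 2) * (2 * e + 1)
      < (n - 1) * (((e + n).choose n : ℤ) - 1) + (e + 1) * (e + 2) := by
  rcases h with ⟨hn, he⟩ | ⟨rfl, he⟩
  · have hmono : (e + 5).choose 5 ≤ (e + n).choose n := by
      rw [← Nat.choose_symm_add, ← Nat.choose_symm_add]
      exact Nat.choose_le_choose e (by omega)
    have hpos : 1 ≤ (e + 5).choose 5 := Nat.choose_pos (by omega)
    zify at hmono hpos hn
    nlinarith [cube_bound_of_choose_five e he]
  · simpa using cube_bound_of_choose_four e he


/-- Lemma 8.1(ii): for `n ≥ 5, d ≥ 3` or `n = 4, d ≥ 5`, with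
`r = ⌊(C(d+n,n) - (nd+1))/(d+1)⌋`, `q = C(d+n,n) - (nd+1) - r(d+1)`,
`r' = ⌊(C(d-1+n,n) - (n(d-1)+1) - q)/d⌋`, and
`q' = C(d-1+n,n) - (n(d-1)+1) - r'd - q`, one has `r - r' - 2q' ≥ 0`. -/
theorem r_sub_rprime_sub_two_qprime_nonneg
    (n d : ℕ) (h : (5 ≤ n ∧ 3 ≤ d) ∨ (n = 4 ∧ 5 ≤ d))
    (r q r' q' : ℤ)
    (hr : r = ((((d+n).choose n : ℤ) - (n*d+1)).fdiv (d+1)))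
    (hq : q = ((d+n).choose n : ℤ) - (n*d+1) - r*(d+1))
    (hr' : r' = ((((d-1+n).choose n : ℤ) - (n*(d-1)+1) - q).fdiv d))
    (hq' : q' = ((d-1+n).choose n : ℤ) - (n*(d-1)+1) - r'*d - q) :
    0 ≤ r - r' - 2*q' := by
  obtain ⟨e, rfl⟩ : ∃ e, d = e + 1 := ⟨d - 1, by omega⟩
  have hbound := cube_bound_of_choose n e (by omega)
  have hchoose : ((e : ℤ) + 1) * ((e + 1 + n).choose n : ℤ)
      = (e + n + 1) * ((e + n).choose n : ℤ) := by
    rw [← Nat.choose_symm_add, ← Nat.choose_symm_add, Nat.add_right_comm e 1 n]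
    have := Nat.add_one_mul_choose_eq (e + n) e
    zify at this
    linarith
  simp only [Nat.add_sub_cancel] at hr' hq'
  push_cast at hr hq hr' hq'
  generalize ((e + n).choose n : ℤ) = B at *
  generalize ((e + 1 + n).choose n : ℤ) = A at *
  have he : (0 : ℤ) ≤ e := by positivity
  have hq0 : 0 ≤ q := by
    have hmod := Int.fmod_nonneg_of_pos (A - (n * (e + 1) + 1)) (b := (e : ℤ) + 1 + 1) (by omega)
    rw [Int.fmod_def, ← hr] at hmod
    linarith
  have hq'e : q' ≤ e := by
    have hmod := Int.fmod_lt_of_pos (B - (n * (e + 1 - 1) + 1) - q) (b := (e : ℤ) + 1) (by omega)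
    rw [Int.fmod_def, ← hr'] at hmod
    linarith
  have key : ((e : ℤ) + 1) * (e + 2) * (r - r' - 2 * q')
      = (n - 1) * (B - 1) + q - (e + 2) * (2 * e + 1) * q' := by
    linear_combination hchoose + (e + 1) * hq - (e + 2) * hq'
  have hlow : ((e : ℤ) + 2) * (2 * e + 1) * q' ≤ (e + 2) * (2 * e + 1) * e := by gcongr
  have hgt : ((e : ℤ) + 1) * (e + 2) * (-1) < (e + 1) * (e + 2) * (r - r' - 2 * q') := by
    linarith
  have := lt_of_mul_lt_mul_left hgt (by positivity)
  omega
end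

section
/- Let n, d be integers with n ≥ 5 and d ≥ 3. With r, q, r', q' as defined, set r̄ = ⌊(C(d+n−2, n−2) − (n−1) − r + r')/d⌋. Then r̄ ≥ 0. -/
theorem mul_le_choose_add_three (m : ℕ) (hm : 3 ≤ m) :
    (m + 2) * (m + 1) ≤ (m + 3).choose m := by
  have h3 := Nat.add_one_mul_choose_eq (m + 2) 2
  have h2 := Nat.add_one_mul_choose_eq (m + 1) 1
  have hsymm : (m + 3).choose m = (m + 3).choose 3 := Nat.choose_symm_add
  rw [Nat.choose_one_right] at h2
  rw [hsymm]
  norm_num [add_assoc] at h2 h3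
  nlinarith

/-- Lemma 8.2(i): for `n ≥ 5, d ≥ 3`, with `r, q, r', q'` as in Lemma 8.1 and
`r̄ = ⌊(C(d+n-2,n-2) - (n-1) - r + r')/d⌋`, one has `r̄ ≥ 0`. -/
theorem rbar_nonneg (n d : ℕ) (hn : 5 ≤ n) (hd : 3 ≤ d)
    (r q r' q' rbar : ℤ)
    (hr : r = ((((d+n).choose n : ℤ) - (n*d+1)).fdiv (d+1)))
    (hq : q = ((d+n).choose n : ℤ) - (n*d+1) - r*(d+1))
    (hr' : r' = ((((d-1+n).choose n : ℤ) - (n*(d-1)+1) - q).fdiv d))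
    (hq' : q' = ((d-1+n).choose n : ℤ) - (n*(d-1)+1) - r'*d - q)
    (hrbar : rbar = ((((d+n-2).choose (n-2) : ℤ) - (n-1) - r + r').fdiv d)) :
    0 ≤ rbar := by
  obtain ⟨m, rfl⟩ := Nat.exists_eq_add_of_le' (show 2 ≤ n by omega)
  obtain ⟨e, rfl⟩ := Nat.exists_eq_add_of_le' (show 1 ≤ d by omega)
  have hm : 3 ≤ m := by omega
  have he : 2 ≤ e := by omega
  have hD : (m + 2) * (m + 1) ≤ (m + e + 1).choose m :=
    (mul_le_choose_add_three m hm).trans (Nat.choose_le_choose m (by omega))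
  have hE := Nat.add_one_mul_choose_eq (m + e + 1) m
  have hA := Nat.choose_succ_succ (m + e + 2) (m + 1)
  rw [show e + 1 + (m + 2) = (m + e + 2).succ by omega] at hr hq hrbar
  rw [show e + 1 - 1 + (m + 2) = m + e + 2 by omega] at hr' hq'
  rw [show (m + e + 2).succ - 2 = m + e + 1 by omega, Nat.add_sub_cancel] at hrbar
  simp only [Nat.succ_eq_add_one] at *
  rw [show m + 1 + 1 = m + 2 by omega] at hA
  generalize (m + e + 2 + 1).choose (m + 2) = A at *
  generalize (m + e + 2).choose (m + 2) = B at *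
  rw [show m + e + 1 + 1 = m + e + 2 by omega] at hE
  generalize (m + e + 2).choose (m + 1) = E at *
  generalize (m + e + 1).choose m = D at *
  have hEge : (m + 2) * (m + e + 2) ≤ E := by
    refine Nat.le_of_mul_le_mul_right (c := m + 1) ?_ (by omega)
    rw [← hE]
    nlinarith
  zify at *
  have hr0 : 0 ≤ r := by
    rw [hr]
    exact Int.fdiv_nonneg (by nlinarith) (by positivity)
  have hq'lt : q' < (e : ℤ) + 1 := by
    have h1 := Int.fmod_lt_of_pos
      ((B : ℤ) - ((m + 2) * (e + 1 - 1) + 1) - q) (show (0 : ℤ) < e + 1 by positivity)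
    rw [Int.fmod_def, ← hr'] at h1
    linarith
  have hmain : (e + 1) * ((m : ℤ) + 1) + E + e ≤ (e + 1) * D + (m + 2) := by
    refine le_of_mul_le_mul_right (a := (m : ℤ) + 1) ?_ (by positivity)
    have hfac : (0 : ℤ) ≤ e * m - 1 := by nlinarith
    have h1 := mul_le_mul_of_nonneg_right hD hfac
    have h2 : (0 : ℤ) ≤ (m + 2) * (m + 1) * (e * (m - 1) - 1) :=
      mul_nonneg (by positivity) (by nlinarith)
    nlinarith
  have hkey : ((e : ℤ) + 1) * (r - r') = E - (m + 2) - r + q' := by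
    rw [hq', hq, hA]
    ring
  rw [hrbar]
  refine Int.fdiv_nonneg ?_ (by positivity)
  refine nonneg_of_mul_nonneg_right (a := (e : ℤ) + 1) ?_ (by positivity)
  linarith
end

section
/- Let n, d be integers with n ≥ 5 and d ≥ 3. With r, q, r', q', r̄ as defined, one has r̄ ≤ r − r' − 2q'. -/
/-- The polynomial lower bound for `C(d+n-2, n-1)`, as a bound in `m = n - 5` and `e = d - 3`. -/
lemma ascending_le_choose (m e : ℕ) :
    (e + 6) * (e + 5) * (e + 4) * (e + 3) ≤ 24 * (e + m + 6).choose (m + 4) := by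
  have hmono : (e + 6).choose (e + 2) ≤ (e + m + 6).choose (e + 2) :=
    Nat.choose_le_choose _ (by omega)
  have hsymm : (e + m + 6).choose (e + 2) = (e + m + 6).choose (m + 4) :=
    Nat.choose_symm_of_eq_add (by omega)
  have hsymm' : (e + 6).choose (e + 2) = (e + 6).choose 4 :=
    Nat.choose_symm_of_eq_add (by omega)
  have hfact : (e + 6).descFactorial 4 = 24 * (e + 6).choose 4 :=
    Nat.descFactorial_eq_factorial_mul_choose _ _
  have hprod : (e + 6).descFactorial 4 = (e + 6) * (e + 5) * (e + 4) * (e + 3) := by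
    simp [Nat.descFactorial]
    ring
  rw [← hprod, hfact, ← hsymm, ← hsymm']
  omega

/-- Lemma 8.2(ii): for `n ≥ 5, d ≥ 3`, with `r, q, r', q'` as in Lemma 8.1 and
`r̄ = ⌊(C(d+n-2,n-2) - (n-1) - r + r')/d⌋`, one has `r̄ ≤ r - r' - 2q'`. -/
theorem rbar_le (n d : ℕ) (hn : 5 ≤ n) (hd : 3 ≤ d)
    (r q r' q' rbar : ℤ)
    (hr : r = ((((d+n).choose n : ℤ) - (n*d+1)).fdiv (d+1)))
    (hq : q = ((d+n).choose n : ℤ) - (n*d+1) - r*(d+1))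
    (hr' : r' = ((((d-1+n).choose n : ℤ) - (n*(d-1)+1) - q).fdiv d))
    (hq' : q' = ((d-1+n).choose n : ℤ) - (n*(d-1)+1) - r'*d - q)
    (hrbar : rbar = ((((d+n-2).choose (n-2) : ℤ) - (n-1) - r + r').fdiv d)) :
    rbar ≤ r - r' - 2*q' := by
  obtain ⟨m, rfl⟩ := Nat.exists_eq_add_of_le' hn
  obtain ⟨e, rfl⟩ := Nat.exists_eq_add_of_le' hd
  have hM := ascending_le_choose m e
  have hpascal : (e + 3 + (m + 5)).choose (m + 5)
      = (e + m + 7).choose (m + 4) + (e + m + 7).choose (m + 5) := by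
    rw [show e + 3 + (m + 5) = e + m + 7 + 1 by ring, Nat.choose_succ_succ]
  have hpascal' : (e + m + 7).choose (m + 4)
      = (e + m + 6).choose (m + 3) + (e + m + 6).choose (m + 4) :=
    Nat.choose_succ_succ _ _
  have habsorb : (e + m + 7) * (e + m + 6).choose (m + 4)
      = (e + m + 7).choose (m + 5) * (m + 5) :=
    Nat.add_one_mul_choose_eq _ _
  rw [hpascal, hpascal'] at hr hq
  rw [show e + 3 - 1 + (m + 5) = e + m + 7 by omega] at hr' hq'
  rw [show e + 3 + (m + 5) - 2 = e + m + 6 by omega, show m + 5 - 2 = m + 3 by omega] at hrbar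
  clear hpascal hpascal'
  generalize (e + m + 6).choose (m + 4) = M at *
  generalize (e + m + 7).choose (m + 5) = P at *
  generalize (e + m + 6).choose (m + 3) = B at *
  rw [Int.fdiv_eq_ediv_of_nonneg _ (by positivity)] at hr hr' hrbar
  have hd_pos : (0 : ℤ) < ((e + 3 : ℕ) : ℤ) := by positivity
  have hd1_pos : (0 : ℤ) < ((e + 3 : ℕ) : ℤ) + 1 := by positivity
  have hq_nonneg : 0 ≤ q := by
    rw [hq, hr]
    exact sub_nonneg.2 (Int.ediv_mul_le _ hd1_pos.ne')
  have hq'_lt : q' < ((e + 3 : ℕ) : ℤ) := by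
    have h := Int.lt_ediv_add_one_mul_self
      ((P : ℤ) - ((m + 5 : ℕ) * ((e + 3 : ℕ) - 1) + 1) - q) hd_pos
    rw [← hr'] at h
    linarith
  have hrbar_mul : rbar * ((e + 3 : ℕ) : ℤ) ≤ (B : ℤ) - ((m + 5 : ℕ) - 1) - r + r' := by
    rw [hrbar]
    exact Int.ediv_mul_le _ hd_pos.ne'
  clear hr hr' hrbar
  zify at habsorb hM
  push_cast at *
  have hgap : 4 * ((e : ℤ) + 2) * M ≤ 5 * ((e + 3) * M - P) := by
    have h : ((m : ℤ) + 5) * (5 * ((e + 3) * M - P) - 4 * ((e : ℤ) + 2) * M)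
        = m * (e + 2) * M := by linear_combination 5 * habsorb
    have h' : (0 : ℤ) ≤ m * (e + 2) * M := by positivity
    have := nonneg_of_mul_nonneg_right (h ▸ h') (by positivity : (0 : ℤ) < (m : ℤ) + 5)
    linarith
  by_contra! hlt
  have hsucc : (r - r' - 2 * q' + 1) * ((e : ℤ) + 3) ≤ rbar * (e + 3) :=
    mul_le_mul_of_nonneg_right hlt hd_pos.le
  have hlin : (M : ℤ) + e + 2 ≤ r' + (2 * e + 5) * q' := by linarith
  have hupper : ((e : ℤ) + 3) * (M + e + 2) ≤ (e + 3) * (r' + (2 * e + 5) * q') :=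
    mul_le_mul_of_nonneg_left hlin hd_pos.le
  have hq'_mul : ((2 * e + 7) * (e + 2) : ℤ) * q' ≤ (2 * e + 7) * (e + 2) * (e + 2) :=
    mul_le_mul_of_nonneg_left (by linarith) (by positivity)
  have hM_mul := mul_le_mul_of_nonneg_left hM (by positivity : (0 : ℤ) ≤ e + 2)
  have hm : (0 : ℤ) ≤ m * (e + 2) := by positivity
  have he : (0 : ℤ) ≤ e := by positivity
  have hpoly : (0 : ℤ) < (e + 2) * ((e + 6) * (e + 5) * (e + 4) * (e + 3))
      + 30 * (5 * (e + 2) + 1 - (e + 3) + (e + 3) ^ 2 - (2 * e + 7) * (e + 2) * (e + 2)) := by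
    nlinarith [pow_nonneg he 2, pow_nonneg he 3, pow_nonneg he 4, pow_nonneg he 5]
  nlinarith
end

section
/- Let n, d be integers with n ≥ 5 and d ≥ 3. With r, q, r', q', r̄, q̄ as defined, one has r' ≥ q' + q̄. -/
theorem le_choose_add (n k : ℕ) : k + 1 ≤ (n + 1 + k).choose (n + 1) := by
  induction k with
  | zero => simp
  | succ k ih =>
    have h : 0 < (n + 1 + k).choose n := Nat.choose_pos (by omega)
    rw [← add_assoc, Nat.choose_succ_succ']
    omega

theorem four_le_choose_three (k : ℕ) : 4 ≤ (k + 8).choose 3 :=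
  le_trans (by decide) (Nat.choose_le_choose 3 (Nat.le_add_left 8 k))

theorem linear_le_choose_four (k : ℕ) : 4 * k + 22 ≤ (k + 8).choose 4 := by
  induction k with
  | zero => decide
  | succ k ih =>
    have h := four_le_choose_three k
    have hc : (k + 1 + 8).choose 4 = (k + 8).choose 3 + (k + 8).choose 4 :=
      Nat.choose_succ_succ' (k + 8) 3
    omega

theorem quadratic_le_choose_five (k : ℕ) :
    2 * (k + 4) ^ 2 + 4 * (k + 3) ≤ (k + 8).choose 5 := by
  induction k with
  | zero => decide
  | succ k ih =>
    have h := linear_le_choose_four k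
    have hc : (k + 1 + 8).choose 5 = (k + 8).choose 4 + (k + 8).choose 5 :=
      Nat.choose_succ_succ' (k + 8) 4
    nlinarith

/-- The lower bound on `C(n + e, n)` propagates from `n` to all larger values. -/
theorem add_mul_le_choose_of_le {m n e c : ℕ} (hmn : m ≤ n) (he : 1 ≤ e)
    (h : c + m * e ≤ (e + m).choose m) : c + n * e ≤ (e + n).choose n := by
  induction n, hmn using Nat.le_induction with
  | base => exact h
  | succ n _ ih =>
    obtain ⟨k, rfl⟩ := Nat.exists_eq_add_of_le' he
    have hk := le_choose_add n k
    rw [← add_assoc, Nat.choose_succ_succ', show k + 1 + n = n + 1 + k by ring]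
    rw [show k + 1 + n = n + 1 + k by ring] at ih
    nlinarith

theorem quadratic_le_choose {n e : ℕ} (hn : 5 ≤ n) (he : 2 ≤ e) (h : e = 2 → n ≠ 5) :
    2 * (e + 1) ^ 2 + n * e ≤ (e + n).choose n + e := by
  rcases he.eq_or_lt with rfl | he
  · have := add_mul_le_choose_of_le (m := 6) (n := n) (e := 2) (c := 16)
      (by have := h rfl; omega) (by omega) (by decide)
    omega
  · obtain ⟨k, rfl⟩ := Nat.exists_eq_add_of_le' he
    have hk := quadratic_le_choose_five k
    have hc : k + 3 ≤ (k + 4) ^ 2 := by nlinarith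
    have := add_mul_le_choose_of_le (m := 5) (n := n) (e := k + 3)
      (c := 2 * (k + 4) ^ 2 - (k + 3)) hn (by omega)
      (by rw [show k + 3 + 5 = k + 8 by ring]; omega)
    change 2 * (k + 4) ^ 2 + n * (k + 3) ≤ (k + 3 + n).choose n + (k + 3)
    omega

theorem sub_fdiv_mul_mem {a b : ℤ} (hb : 0 < b) :
    0 ≤ a - a.fdiv b * b ∧ a - a.fdiv b * b < b := by
  have h := Int.emod_add_mul_ediv a b
  rw [Int.fdiv_eq_ediv_of_nonneg _ hb.le, mul_comm]
  have := Int.emod_nonneg a hb.ne'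
  have := Int.emod_lt_of_pos a hb
  constructor <;> linarith


/-- Lemma 8.2(iii): for `n ≥ 5, d ≥ 3`, with `r, q, r', q'` as in Lemma 8.1,
`r̄ = ⌊(C(d+n-2,n-2) - (n-1) - r + r')/d⌋`, and
`q̄ = C(d+n-2,n-2) - (n-1) - r̄d - r + r'`, one has `r' ≥ q' + q̄`. -/
theorem rprime_ge_qprime_add_qbar (n d : ℕ) (hn : 5 ≤ n) (hd : 3 ≤ d)
    (r q r' q' rbar qbar : ℤ)
    (hr : r = ((((d+n).choose n : ℤ) - (n*d+1)).fdiv (d+1)))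
    (hq : q = ((d+n).choose n : ℤ) - (n*d+1) - r*(d+1))
    (hr' : r' = ((((d-1+n).choose n : ℤ) - (n*(d-1)+1) - q).fdiv d))
    (hq' : q' = ((d-1+n).choose n : ℤ) - (n*(d-1)+1) - r'*d - q)
    (hrbar : rbar = ((((d+n-2).choose (n-2) : ℤ) - (n-1) - r + r').fdiv d))
    (hqbar : qbar = ((d+n-2).choose (n-2) : ℤ) - (n-1) - rbar*d - r + r') :
    q' + qbar ≤ r' := by
  by_cases h : d = 3 ∧ n = 5
  · obtain ⟨rfl, rfl⟩ := h
    subst hqbar hrbar hq' hr' hq hr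
    decide
  obtain ⟨e, rfl⟩ : ∃ e, d = e + 1 := ⟨d - 1, by omega⟩
  have key := quadratic_le_choose (e := e) hn (by omega) (by omega)
  zify at key
  have hq_lt : q < e + 2 := by
    have := (sub_fdiv_mul_mem (a := ((e + 1 + n).choose n : ℤ) - (n * ((e + 1 : ℕ) : ℤ) + 1))
      (b := ((e + 1 : ℕ) : ℤ) + 1) (by positivity)).2
    rw [← hr, ← hq] at this
    push_cast at this
    linarith
  have hq'_lt : q' < e + 1 := by
    have := (sub_fdiv_mul_mem
      (a := ((e + 1 - 1 + n).choose n : ℤ) - (n * (((e + 1 : ℕ) : ℤ) - 1) + 1) - q)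
      (b := ((e + 1 : ℕ) : ℤ)) (by positivity)).2
    rw [← hr'] at this
    push_cast at this hq'
    linarith
  have hqbar_lt : qbar < e + 1 := by
    have := (sub_fdiv_mul_mem
      (a := ((e + 1 + n - 2).choose (n - 2) : ℤ) - (n - 1) - r + r')
      (b := ((e + 1 : ℕ) : ℤ)) (by positivity)).2
    rw [← hrbar] at this
    push_cast at this hqbar
    linarith
  have hr'_ge : 2 * (e : ℤ) ≤ r' := by
    rw [hr', Int.fdiv_eq_ediv_of_nonneg _ (by positivity), Int.le_ediv_iff_mul_le (by positivity)]
    simp only [Nat.add_sub_cancel]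
    push_cast
    nlinarith
  linarith
end

section
/- Let n, d be integers with n ≥ 5 and d ≥ 3. With r, q, r', q', r̄, q̄ as defined, the following identity holds: C(d+n−2, n−1) − (r − r' − r̄)·d = r' − q' − q̄ + 1. -/
/-- Lemma 8.2(iv): for `n ≥ 5, d ≥ 3`, with `r, q, r', q', r̄, q̄` as in Lemma 8.2,
one has `C(d+n-2,n-1) - (r - r' - r̄)d = r' - q' - q̄ + 1`. -/
theorem trace_count_identity (n d : ℕ) (hn : 5 ≤ n) (hd : 3 ≤ d)
    (r q r' q' rbar qbar : ℤ)
    (hr : r = ((((d+n).choose n : ℤ) - (n*d+1)).fdiv (d+1)))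
    (hq : q = ((d+n).choose n : ℤ) - (n*d+1) - r*(d+1))
    (hr' : r' = ((((d-1+n).choose n : ℤ) - (n*(d-1)+1) - q).fdiv d))
    (hq' : q' = ((d-1+n).choose n : ℤ) - (n*(d-1)+1) - r'*d - q)
    (hrbar : rbar = ((((d+n-2).choose (n-2) : ℤ) - (n-1) - r + r').fdiv d))
    (hqbar : qbar = ((d+n-2).choose (n-2) : ℤ) - (n-1) - rbar*d - r + r') :
    ((d+n-2).choose (n-1) : ℤ) - (r - r' - rbar)*d = r' - q' - qbar + 1 := by
  have pascal : (d+n).choose n =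
      (d-1+n).choose n + (d+n-2).choose (n-2) + (d+n-2).choose (n-1) := by
    obtain ⟨m, rfl⟩ := Nat.exists_eq_add_of_le' (show 2 ≤ n by omega)
    obtain ⟨e, rfl⟩ := Nat.exists_eq_add_of_le' (show 1 ≤ d by omega)
    rw [show e + 1 + (m + 2) = (e + m + 1) + 1 + 1 by omega,
      show e + 1 - 1 + (m + 2) = (e + m + 1) + 1 by omega,
      show e + m + 1 + 1 + 1 - 2 = e + m + 1 by omega,
      show m + 2 - 2 = m by omega, show m + 2 - 1 = m + 1 by omega,
      Nat.choose_succ_succ' (e + m + 1 + 1) (m + 1), Nat.choose_succ_succ' (e + m + 1) m]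
    ring
  have pascal_int : ((d+n).choose n : ℤ) =
      (d-1+n).choose n + (d+n-2).choose (n-2) + (d+n-2).choose (n-1) := by
    exact_mod_cast pascal
  linear_combination hq' + hqbar - hq - pascal_int
end

section
/- Let d ≥ 5 be an integer and let r, q, r', q' be as defined with n = 4. Set x = r − r' − 2q' and r̂ = ⌊((d+1)^2 − (d+2)q' − 2x)/(d−1)⌋. Then r̂ ≥ 0 (and consequently q̂ = (d+1)^2 − (d+2)q' − (d−1)r̂ − 2x ≥ 0). -/
/-- Characterisation of the floor quotient by its remainder. -/
theorem Int.fdiv_eq_of_remainder {n b e : ℤ} (h₀ : 0 ≤ n - e * b) (h₁ : n - e * b < b) :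
    n.fdiv b = e := by
  have hb : 0 < b := h₀.trans_lt h₁
  rw [Int.fdiv_eq_ediv_of_nonneg _ hb.le]
  apply le_antisymm
  · exact Int.lt_add_one_iff.mp (Int.ediv_lt_of_lt_mul hb (by linarith))
  · exact (Int.le_ediv_iff_mul_le hb).mpr (by linarith)

theorem Int.mul_choose_four (d : ℕ) :
    24 * (((d + 3).choose 4 : ℕ) : ℤ) = d * ((d + 1) * (d + 2) * (d + 3)) := by
  have h := Nat.descFactorial_eq_factorial_mul_choose (d + 3) 4
  simp only [Nat.descFactorial_succ, Nat.descFactorial_zero, Nat.factorial] at h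
  have h₁ : d + 3 - 3 = d := by omega
  have h₂ : d + 3 - 2 = d + 1 := by omega
  have h₃ : d + 3 - 1 = d + 2 := by omega
  rw [h₁, h₂, h₃, Nat.sub_zero] at h
  zify at h
  push_cast at h ⊢
  linear_combination -h

/-- Residues modulo `24` of the products of three consecutive integers starting at `d + 2` and
at `d + 1`; their difference modulo `24` is at most `18`. -/
theorem consecutive_products_emod (d : ℤ) :
    ∃ c : ℤ, 0 ≤ c ∧ c ≤ 1 ∧
      ((d + 2) * (d + 3) * (d + 4)) % 24 ≤ 18 ∧ ((d + 1) * (d + 2) * (d + 3)) % 24 ≤ 18 ∧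
      24 * c + ((d + 1) * (d + 2) * (d + 3)) % 24 - ((d + 2) * (d + 3) * (d + 4)) % 24 ≤ 18 ∧
      (1 ≤ 24 * c + ((d + 1) * (d + 2) * (d + 3)) % 24 - ((d + 2) * (d + 3) * (d + 4)) % 24 ∨
        24 * c + ((d + 1) * (d + 2) * (d + 3)) % 24 - ((d + 2) * (d + 3) * (d + 4)) % 24 = 0 ∧
        ((d + 2) * (d + 3) * (d + 4)) % 24 = 0) := by
  have hmod : d % 24 ≡ d [ZMOD 24] := Int.mod_modEq d 24
  have ha : ((d + 2) * (d + 3) * (d + 4)) % 24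
      = ((d % 24 + 2) * (d % 24 + 3) * (d % 24 + 4)) % 24 :=
    (((hmod.add_right 2).mul (hmod.add_right 3)).mul (hmod.add_right 4)).symm
  have hb : ((d + 1) * (d + 2) * (d + 3)) % 24
      = ((d % 24 + 1) * (d % 24 + 2) * (d % 24 + 3)) % 24 :=
    (((hmod.add_right 1).mul (hmod.add_right 2)).mul (hmod.add_right 3)).symm
  rw [ha, hb]
  have h₀ : 0 ≤ d % 24 := Int.emod_nonneg d (by norm_num)
  have h₁ : d % 24 < 24 := Int.emod_lt_of_pos d (by norm_num)
  generalize d % 24 = s at h₀ h₁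
  interval_cases s <;> first | exact ⟨0, by decide⟩ | exact ⟨1, by decide⟩

/-- Nonnegativity of the numerator of `r̂` for large `d`. -/
theorem rhat_numerator_nonneg_of_large {d C C' r q r' q' : ℤ} (hd : 18 ≤ d)
    (hC : 24 * C = (d + 1) * ((d + 2) * (d + 3) * (d + 4)))
    (hC' : 24 * C' = d * ((d + 1) * (d + 2) * (d + 3)))
    (hr : r = (C - (4 * d + 1)).fdiv (d + 1))
    (hq : q = C - (4 * d + 1) - r * (d + 1))
    (hr' : r' = (C' - (4 * (d - 1) + 1) - q).fdiv d)
    (hq' : q' = C' - (4 * (d - 1) + 1) - r' * d - q) :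
    0 ≤ (d + 1) ^ 2 - (d + 2) * q' - 2 * (r - r' - 2 * q') := by
  obtain ⟨c, hc₀, hc₁, ha₁, hb₁, he₁, he₀⟩ := consecutive_products_emod d
  have hm := Int.emod_add_mul_ediv ((d + 2) * (d + 3) * (d + 4)) 24
  have hm' := Int.emod_add_mul_ediv ((d + 1) * (d + 2) * (d + 3)) 24
  have ha₀ := Int.emod_nonneg ((d + 2) * (d + 3) * (d + 4)) (show (24 : ℤ) ≠ 0 by norm_num)
  have hb₀ := Int.emod_nonneg ((d + 1) * (d + 2) * (d + 3)) (show (24 : ℤ) ≠ 0 by norm_num)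
  generalize ((d + 2) * (d + 3) * (d + 4)) % 24 = a at *
  generalize ((d + 1) * (d + 2) * (d + 3)) % 24 = b at *
  generalize ((d + 2) * (d + 3) * (d + 4)) / 24 = m at *
  generalize ((d + 1) * (d + 2) * (d + 3)) / 24 = m' at *
  obtain ⟨e, he⟩ : ∃ e, e = 24 * c + b - a := ⟨_, rfl⟩
  rw [← he] at he₁ he₀
  have hq₂₄ : 24 * (C - (4 * d + 1) - (m - 4) * (d + 1)) = 72 + (d + 1) * a := by
    rw [← hm] at hC
    linear_combination hC
  have hrm : r = m - 4 := by
    rw [hr]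
    apply Int.fdiv_eq_of_remainder <;> nlinarith
  rw [← hrm, ← hq] at hq₂₄
  have hq'₂₄ : 24 * (C' - (4 * (d - 1) + 1) - q - (m' - 4 - c) * d) = d * e - a := by
    rw [← hm'] at hC'
    rw [he]
    linear_combination hC' - hq₂₄
  have hde : a ≤ d * e := by
    rcases he₀ with h | ⟨h, h'⟩
    · nlinarith
    · rw [h, h', mul_zero]
  have hrm' : r' = m' - 4 - c := by
    rw [hr']
    apply Int.fdiv_eq_of_remainder <;> nlinarith
  have hq'e : 24 * q' = d * e - a := by
    rw [hq', hrm']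
    linear_combination hq'₂₄
  have hN : 24 * ((d + 1) ^ 2 - (d + 2) * q' - 2 * (r - r' - 2 * q'))
      = (18 - e) * (d * (d - 2)) + (d - 2) * a + 54 * d - 12 + 2 * (a - b) - 48 * c := by
    rw [hrm, hrm']
    linear_combination (2 - d) * hq'e - 2 * hm + 2 * hm'
  have h₁ : 0 ≤ (18 - e) * (d * (d - 2)) :=
    mul_nonneg (by linarith) (mul_nonneg (by linarith) (by linarith))
  have h₂ : 0 ≤ (d - 2) * a := mul_nonneg (by linarith) ha₀
  linarith

/-- Lemma 8.3(i): for `d ≥ 5` and `n = 4`, with `r, q, r', q'` as in Lemma 8.1,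
`x = r - r' - 2q'`, `r̂ = ⌊((d+1)² - (d+2)q' - 2x)/(d-1)⌋`, and
`q̂ = (d+1)² - (d+2)q' - (d-1)r̂ - 2x`, one has `r̂ ≥ 0` and consequently `q̂ ≥ 0`. -/
theorem rhat_nonneg (d : ℕ) (hd : 5 ≤ d)
    (r q r' q' x rhat qhat : ℤ)
    (hr : r = ((((d+4).choose 4 : ℤ) - (4*d+1)).fdiv (d+1)))
    (hq : q = ((d+4).choose 4 : ℤ) - (4*d+1) - r*(d+1))
    (hr' : r' = ((((d+3).choose 4 : ℤ) - (4*(d-1)+1) - q).fdiv d))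
    (hq' : q' = ((d+3).choose 4 : ℤ) - (4*(d-1)+1) - r'*d - q)
    (hx : x = r - r' - 2*q')
    (hrhat : rhat = ((((d:ℤ)+1)^2 - (d+2)*q' - 2*x).fdiv (d-1)))
    (hqhat : qhat = ((d:ℤ)+1)^2 - (d+2)*q' - (d-1)*rhat - 2*x) :
    0 ≤ rhat ∧ 0 ≤ qhat := by
  have hN : 0 ≤ ((d : ℤ) + 1) ^ 2 - (d + 2) * q' - 2 * x := by
    rw [hx]
    rcases lt_or_ge d 18 with h | h
    · subst hq' hr' hq hr
      clear hx hrhat hqhat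
      interval_cases d <;> decide
    · refine rhat_numerator_nonneg_of_large (by exact_mod_cast h) ?_ (Int.mul_choose_four d)
        hr hq hr' hq'
      have := Int.mul_choose_four (d + 1)
      push_cast at this
      linear_combination this
  have hd₁ : 0 < (d : ℤ) - 1 := by
    have : (5 : ℤ) ≤ d := by exact_mod_cast hd
    linarith
  rw [Int.fdiv_eq_ediv_of_nonneg _ hd₁.le] at hrhat
  refine ⟨hrhat ▸ Int.ediv_nonneg hN hd₁.le, ?_⟩
  have := Int.emod_nonneg (((d : ℤ) + 1) ^ 2 - (d + 2) * q' - 2 * x) hd₁.ne'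
  rw [Int.emod_def, ← hrhat] at this
  linarith
end

section
/- Let d ≥ 5 be an integer and let r, q, r', q', x, r̂ be as defined with n = 4. Then r̂ ≤ r − r' − 2q'. -/
theorem twenty_four_mul_choose_four (n : ℕ) :
    24 * ((n + 4).choose 4 : ℤ) = (n + 1) * (n + 2) * (n + 3) * (n + 4) := by
  have h := Nat.ascFactorial_eq_factorial_mul_choose n 4
  simp only [Nat.ascFactorial, Nat.factorial] at h
  zify at h
  linarith


/-- Lemma 8.3(ii): for `d ≥ 5` and `n = 4`, with notation as in Lemma 8.3,
one has `r̂ ≤ r - r' - 2q'`. -/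
theorem rhat_le (d : ℕ) (hd : 5 ≤ d)
    (r q r' q' x rhat qhat : ℤ)
    (hr : r = ((((d+4).choose 4 : ℤ) - (4*d+1)).fdiv (d+1)))
    (hq : q = ((d+4).choose 4 : ℤ) - (4*d+1) - r*(d+1))
    (hr' : r' = ((((d+3).choose 4 : ℤ) - (4*(d-1)+1) - q).fdiv d))
    (hq' : q' = ((d+3).choose 4 : ℤ) - (4*(d-1)+1) - r'*d - q)
    (hx : x = r - r' - 2*q')
    (hrhat : rhat = ((((d:ℤ)+1)^2 - (d+2)*q' - 2*x).fdiv (d-1)))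
    (hqhat : qhat = ((d:ℤ)+1)^2 - (d+2)*q' - (d-1)*rhat - 2*x) :
    rhat ≤ r - r' - 2*q' := by
  rw [← hx]
  rcases lt_or_ge d 12 with hlt | hge
  · clear hqhat
    subst hrhat hx hq' hr' hq hr
    interval_cases d <;> decide
  obtain ⟨e, rfl⟩ : ∃ e, d = e + 1 := ⟨d - 1, by omega⟩
  have hA := twenty_four_mul_choose_four (e + 1)
  have hB := twenty_four_mul_choose_four e
  rw [show e + 1 + 3 = e + 4 from rfl] at hr' hq'
  generalize ((e + 1 + 4).choose 4 : ℤ) = A at *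
  generalize ((e + 4).choose 4 : ℤ) = B at *
  push_cast at *
  have he : (11 : ℤ) ≤ e := by omega
  generalize (e : ℤ) = k at *
  have hq_nonneg : 0 ≤ q := by
    rw [hq, hr, Int.fdiv_eq_ediv_of_nonneg _ (by linarith)]
    linarith [Int.ediv_mul_le (A - (4 * (k + 1) + 1)) (show k + 1 + 1 ≠ 0 by linarith)]
  have hq'_eq : q' = (B - (4 * (k + 1 - 1) + 1) - q) % (k + 1) := by
    rw [hq', hr', Int.fdiv_eq_ediv_of_nonneg _ (by linarith), Int.emod_def]
    ring
  have hq'_nonneg : 0 ≤ q' := hq'_eq ▸ Int.emod_nonneg _ (by linarith)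
  have hq'_lt : q' < k + 1 := hq'_eq ▸ Int.emod_lt_of_pos _ (by linarith)
  rw [hrhat, Int.fdiv_eq_ediv_of_nonneg _ (by linarith)]
  refine Int.lt_add_one_iff.mp (Int.ediv_lt_of_lt_mul (by linarith) ?_)
  have hdiff : (k + 1) * (k + 2) * (r - r') =
      (k + 2) * (A - B - 4 + q') - (A - (4 * (k + 1) + 1) - q) := by
    rw [hq', hq]
    ring
  have hpoly : 48 * (k + 1) * ((k + 1) ^ 2 + 1) <
      3 * (k + 1) * (k + 2) * (k + 3) * (k + 4) - 72 := by
    obtain ⟨m, rfl⟩ : ∃ m, k = m + 11 := ⟨k - 11, by ring⟩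
    have hm : 0 ≤ m := by linarith
    rw [← sub_pos]
    ring_nf
    positivity
  have hmul : 0 ≤ (k + 2) * q' := by positivity
  have hkey : 2 * (k + 1) ^ 2 + 2 < (k + 2) * (r - r') := by
    refine lt_of_mul_lt_mul_left (a := k + 1) ?_ (by linarith)
    have hP : 24 * ((k + 2) * (A - B - 4) - (A - (4 * (k + 1) + 1))) =
        3 * (k + 1) * (k + 2) * (k + 3) * (k + 4) - 72 := by
      linear_combination (k + 1) * hA - (k + 2) * hB
    linarith
  have hbound : (k + 1) * q' ≤ (k + 1) * k :=
    mul_le_mul_of_nonneg_left (by linarith) (by linarith)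
  rw [hx]
  linarith
end

section
/- Let d ≥ 5 be an integer and let r, q, r', q', x, r̂, q̂ be as defined with n = 4. Then q̂ ≤ r'. -/
theorem Int.sub_fdiv_mul_nonneg_and_lt (a : ℤ) {b : ℤ} (hb : 0 < b) :
    0 ≤ a - a.fdiv b * b ∧ a - a.fdiv b * b < b := by
  rw [Int.fdiv_eq_ediv_of_nonneg a hb.le]
  have h := Int.emod_add_mul_ediv a b
  have h₀ := Int.emod_nonneg a hb.ne'
  have h₁ := Int.emod_lt_of_pos a hb
  constructor <;> linarith

theorem Nat.cast_choose_add_three_four (d : ℕ) :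
    24 * ((d + 3).choose 4 : ℤ) = (d + 3) * (d + 2) * (d + 1) * d := by
  have h := Nat.descFactorial_eq_factorial_mul_choose (d + 3) 4
  simp only [Nat.descFactorial_succ, Nat.descFactorial_zero, Nat.factorial] at h
  simp only [show d + 3 - 3 = d by omega, show d + 3 - 2 = d + 1 by omega,
    show d + 3 - 1 = d + 2 by omega, Nat.sub_zero] at h
  zify at h
  linarith

/-- Lemma 8.3(iii): for `d ≥ 5` and `n = 4`, with notation as in Lemma 8.3,
one has `q̂ ≤ r'`. -/
theorem qhat_le_rprime (d : ℕ) (hd : 5 ≤ d)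
    (r q r' q' x rhat qhat : ℤ)
    (hr : r = ((((d+4).choose 4 : ℤ) - (4*d+1)).fdiv (d+1)))
    (hq : q = ((d+4).choose 4 : ℤ) - (4*d+1) - r*(d+1))
    (hr' : r' = ((((d+3).choose 4 : ℤ) - (4*(d-1)+1) - q).fdiv d))
    (hq' : q' = ((d+3).choose 4 : ℤ) - (4*(d-1)+1) - r'*d - q)
    (hx : x = r - r' - 2*q')
    (hrhat : rhat = ((((d:ℤ)+1)^2 - (d+2)*q' - 2*x).fdiv (d-1)))
    (hqhat : qhat = ((d:ℤ)+1)^2 - (d+2)*q' - (d-1)*rhat - 2*x) :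
    qhat ≤ r' := by
  have hd' : (5 : ℤ) ≤ d := by exact_mod_cast hd
  have hq_lt : q < d + 1 := by
    rw [hq, hr]
    exact (Int.sub_fdiv_mul_nonneg_and_lt _ (by linarith)).2
  have hq'_lt : q' < d := by
    have h := (Int.sub_fdiv_mul_nonneg_and_lt
      (((d + 3).choose 4 : ℤ) - (4 * (d - 1) + 1) - q) (b := d) (by linarith)).2
    rw [← hr'] at h
    linarith
  have hqhat_lt : qhat < d - 1 := by
    have h := (Int.sub_fdiv_mul_nonneg_and_lt
      (((d : ℤ) + 1) ^ 2 - (d + 2) * q' - 2 * x) (b := d - 1) (by linarith)).2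
    rw [← hrhat] at h
    linarith
  have hchoose := Nat.cast_choose_add_three_four d
  by_contra! hlt
  have hle : r' * d ≤ (d - 3) * d :=
    mul_le_mul_of_nonneg_right (by linarith) (by linarith)
  have hm : (40 : ℤ) ≤ d ^ 2 + 3 * d := by nlinarith
  nlinarith
end

section
/- Let d ≥ 5 be an integer and let r, q, r', q', x, r̂ be as defined with n = 4. Then q' + r̂ ≤ d. -/
theorem Int.fdiv_mul_add_bounds {a b c : ℤ} (hb : 0 < b) (hc : c = a - a.fdiv b * b) :
    0 ≤ c ∧ c < b := by
  have h : c = a % b := by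
    rw [hc, Int.fdiv_eq_ediv_of_nonneg _ hb.le, Int.emod_def, mul_comm]
  exact h ▸ ⟨Int.emod_nonneg _ hb.ne', Int.emod_lt_of_pos _ hb⟩

theorem Nat.cast_add_four_choose_four (d : ℕ) :
    24 * ((d + 4).choose 4 : ℤ) = (d + 1) * (d + 2) * (d + 3) * (d + 4) := by
  have h := Nat.descFactorial_eq_factorial_mul_choose (d + 4) 4
  simp only [Nat.descFactorial, Nat.factorial] at h
  have h' : (d + 1) * ((d + 2) * ((d + 3) * (d + 4))) = 24 * (d + 4).choose 4 := by
    simpa using h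
  rw [show (d + 1 : ℤ) * (d + 2) * (d + 3) * (d + 4)
    = (d + 1) * ((d + 2) * ((d + 3) * (d + 4))) by ring]
  exact_mod_cast h'.symm

theorem Nat.cast_add_three_choose_four (d : ℕ) (hd : 0 < d) :
    24 * ((d + 3).choose 4 : ℤ) = d * (d + 1) * (d + 2) * (d + 3) := by
  obtain ⟨e, rfl⟩ := Nat.exists_eq_add_of_lt hd
  have h := Nat.cast_add_four_choose_four e
  rw [show 0 + e + 1 + 3 = e + 4 by ring, h]
  push_cast
  ring

/-- Lemma 8.3(iv): for `d ≥ 5` and `n = 4`, with notation as in Lemma 8.3,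
one has `q' + r̂ ≤ d`. -/
theorem qprime_add_rhat_le_d (d : ℕ) (hd : 5 ≤ d)
    (r q r' q' x rhat qhat : ℤ)
    (hr : r = ((((d+4).choose 4 : ℤ) - (4*d+1)).fdiv (d+1)))
    (hq : q = ((d+4).choose 4 : ℤ) - (4*d+1) - r*(d+1))
    (hr' : r' = ((((d+3).choose 4 : ℤ) - (4*(d-1)+1) - q).fdiv d))
    (hq' : q' = ((d+3).choose 4 : ℤ) - (4*(d-1)+1) - r'*d - q)
    (hx : x = r - r' - 2*q')
    (hrhat : rhat = ((((d:ℤ)+1)^2 - (d+2)*q' - 2*x).fdiv (d-1)))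
    (hqhat : qhat = ((d:ℤ)+1)^2 - (d+2)*q' - (d-1)*rhat - 2*x) :
    q' + rhat ≤ (d : ℤ) := by
  obtain hd6 | hd7 : d ≤ 6 ∨ 7 ≤ d := by omega
  · subst hqhat hrhat hx hq' hr' hq hr
    interval_cases d <;> decide
  have hA := Nat.cast_add_four_choose_four d
  have hB := Nat.cast_add_three_choose_four d (by omega)
  generalize ((d + 4).choose 4 : ℤ) = A at *
  generalize ((d + 3).choose 4 : ℤ) = B at *
  have hdz : (7 : ℤ) ≤ d := by exact_mod_cast hd7
  generalize (d : ℤ) = D at *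
  have hq_nonneg : 0 ≤ q :=
    (Int.fdiv_mul_add_bounds (a := A - (4 * D + 1)) (b := D + 1) (by linarith)
      (by rw [hq, hr])).1
  obtain ⟨hq'_nonneg, hq'_lt⟩ : 0 ≤ q' ∧ q' < D :=
    Int.fdiv_mul_add_bounds (a := B - (4 * (D - 1) + 1) - q) (by linarith)
      (by rw [hq', hr']; ring)
  have hqhat_nonneg : 0 ≤ qhat :=
    (Int.fdiv_mul_add_bounds (a := (D + 1) ^ 2 - (D + 2) * q' - 2 * x) (b := D - 1) (by linarith)
      (by rw [hqhat, hrhat]; ring)).1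
  clear hr hr' hrhat
  have key : 24 * ((D + 1) * D) * (r - r')
      = 3 * ((D + 1) * D * ((D + 2) * (D + 3))) - 72 + 24 * (q' * (D + 1) + q) := by
    linear_combination (24 * D) * hq - (24 * (D + 1)) * hq' + D * hA - (D + 1) * hB
  have hk : (D + 2) * (D + 3) ≤ 8 * (r - r') := by
    by_contra! h
    nlinarith [mul_nonneg hq'_nonneg (by linarith : (0 : ℤ) ≤ D + 1),
      mul_le_mul_of_nonneg_left (Int.add_one_le_iff.mpr h)
        (by positivity : (0 : ℤ) ≤ (D + 1) * D)]
  by_contra! h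
  nlinarith [mul_le_mul_of_nonneg_right (Int.add_one_le_iff.mpr h)
    (by linarith : (0 : ℤ) ≤ D - 1)]
end

section
/- Let d ≥ 5 be an integer and let r, q, r', q', x, r̂, q̂ be as defined with n = 4. Then the following identity holds: r' − q̂ = C(d+1, 3) − 4 − (d−1)·(r − r' − r̂ − q'). -/
/-- Lemma 8.3(v): for `d ≥ 5` and `n = 4`, with notation as in Lemma 8.3,
one has `r' - q̂ = C(d+1,3) - 4 - (d-1)(r - r' - r̂ - q')`. -/
theorem residual_count_identity (d : ℕ) (hd : 5 ≤ d)
    (r q r' q' x rhat qhat : ℤ)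
    (hr : r = ((((d+4).choose 4 : ℤ) - (4*d+1)).fdiv (d+1)))
    (hq : q = ((d+4).choose 4 : ℤ) - (4*d+1) - r*(d+1))
    (hr' : r' = ((((d+3).choose 4 : ℤ) - (4*(d-1)+1) - q).fdiv d))
    (hq' : q' = ((d+3).choose 4 : ℤ) - (4*(d-1)+1) - r'*d - q)
    (hx : x = r - r' - 2*q')
    (hrhat : rhat = ((((d:ℤ)+1)^2 - (d+2)*q' - 2*x).fdiv (d-1)))
    (hqhat : qhat = ((d:ℤ)+1)^2 - (d+2)*q' - (d-1)*rhat - 2*x) :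
    r' - qhat = ((d+1).choose 3 : ℤ) - 4 - ((d:ℤ)-1)*(r - r' - rhat - q') := by
  have h₄ : (d + 4).choose 4 = (d + 3).choose 3 + (d + 3).choose 4 := Nat.choose_succ_succ' _ _
  have h₃ : (d + 3).choose 3 = (d + 2).choose 2 + ((d + 1).choose 2 + (d + 1).choose 3) := by
    rw [Nat.choose_succ_succ' (d + 2) 2, Nat.choose_succ_succ' (d + 1) 2]
  have h₂ : (d + 2).choose 2 + (d + 1).choose 2 = (d + 1) ^ 2 := by
    rw [Nat.choose_succ_succ' (d + 1) 1, Nat.choose_one_right]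
    rw [Nat.choose_two_right, Nat.triangle_succ]
    nlinarith [Nat.div_two_mul_two_of_even (Nat.even_mul_pred_self d),
      Nat.sub_add_cancel (by omega : 1 ≤ d)]
  zify at h₄ h₃ h₂
  subst hx hqhat
  linear_combination hq - hq' + h₄ + h₃ + h₂
end
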